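/- Let M be a smooth, strictly convex hypersurface (embedded n-disk) perpendicular to S^n from the inside, and suppose there are a unit vector e₀ ∈ ℝ^{n+1} and a constant c₀ < 0 such that ⟨N, e₀⟩ ≤ c₀ everywhere on M. Then ∫_M H dμ ≤ -c₀^{-1} · ∫_{∂M} ⟨x, e₀⟩ dσ(x), where dσ is the (n-1)-dimensional surface measure on ∂M. (This follows since the height function w = ⟨X, e₀⟩ satisfies Δw = -H⟨N, e₀⟩ on M and the Neumann condition ⟨∇w, Ñ⟩ = w on ∂M.) -/

import Mathlib

open Metric Set MeasureTheory Filter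
open scoped RealInnerProductSpace ENNReal NNReal

noncomputable section

/-- Euclidean space `ℝ^n`. -/
abbrev Euc (n : ℕ) := EuclideanSpace ℝ (Fin n)

/-- The closed unit `n`-disk `𝔻`. -/
def Disk (n : ℕ) : Set (Euc n) := Metric.closedBall 0 1

/-- The boundary `∂𝔻` of the unit disk, i.e. the unit sphere `S^{n-1} ⊂ ℝ^n`. -/
def DiskBdry (n : ℕ) : Set (Euc n) := Metric.sphere 0 1

/-- A smoothly embedded `n`-disk hypersurface `M ⊂ ℝ^{n+1}`, given by a smooth embedding
`X : 𝔻 → ℝ^{n+1}` (presented by a map defined on all of `ℝ^n`, smooth, injective and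
immersive on `𝔻`) together with a chosen smooth unit normal field `N`. -/
structure HypDisk (n : ℕ) where
  X : Euc n → Euc (n+1)
  N : Euc n → Euc (n+1)
  smoothX : ContDiffOn ℝ (⊤ : ℕ∞) X (Disk n)
  smoothN : ContDiffOn ℝ (⊤ : ℕ∞) N (Disk n)
  injX : Set.InjOn X (Disk n)
  immersion : ∀ x ∈ Disk n, Function.Injective (fderivWithin ℝ X (Disk n) x)
  unitN : ∀ x ∈ Disk n, ‖N x‖ = 1
  perpN : ∀ x ∈ Disk n, ∀ v : Euc n, ⟪fderivWithin ℝ X (Disk n) x v, N x⟫ = 0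

variable {n : ℕ}

/-- The induced metric `g_ij = ⟨∂_i X, ∂_j X⟩`. -/
def gmet (S : HypDisk n) (x : Euc n) : Matrix (Fin n) (Fin n) ℝ :=
  Matrix.of fun i j =>
    ⟪fderivWithin ℝ S.X (Disk n) x (EuclideanSpace.single i 1),
      fderivWithin ℝ S.X (Disk n) x (EuclideanSpace.single j 1)⟫

/-- The second fundamental form `h_ij = -⟨∂_i ∂_j X, N⟩`. -/
def sff (S : HypDisk n) (x : Euc n) : Matrix (Fin n) (Fin n) ℝ :=
  Matrix.of fun i j =>
    -⟪fderivWithin ℝ (fun y => fderivWithin ℝ S.X (Disk n) y (EuclideanSpace.single i 1))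
        (Disk n) x (EuclideanSpace.single j 1), S.N x⟫

/-- The mean curvature `H = g^{ij} h_ij`. -/
def meanCurv (S : HypDisk n) (x : Euc n) : ℝ := ((gmet S x)⁻¹ * sff S x).trace

/-- `M` is (weakly) convex: the second fundamental form is positive semidefinite everywhere. -/
def WeaklyConvex (S : HypDisk n) : Prop := ∀ x ∈ Disk n, (sff S x).PosSemidef

/-- `M` is strictly convex: the second fundamental form is positive definite everywhere. -/
def StrictlyConvex (S : HypDisk n) : Prop := ∀ x ∈ Disk n, (sff S x).PosDef

/-- `M` is perpendicular to the sphere `S^n` from the inside: `∂M ⊂ S^n`, the normal `N` of `M`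
is orthogonal to the outward normal `Ñ(x) = x` of `S^n` along `∂M`, and `⟨γ'(0), Ñ⟩ ≥ 0` for
every `C¹` curve `γ : (-ε, 0] → M` ending on `∂M`. -/
def PerpFromInside (S : HypDisk n) : Prop :=
  (∀ x ∈ DiskBdry n, S.X x ∈ Metric.sphere (0 : Euc (n+1)) 1) ∧
  (∀ x ∈ DiskBdry n, ⟪S.N x, S.X x⟫ = 0) ∧
  (∀ (γ : ℝ → Euc (n+1)) (ε : ℝ), 0 < ε →
    ContDiffOn ℝ 1 γ (Set.Icc (-ε) 0) →
    (∀ t ∈ Set.Icc (-ε) 0, γ t ∈ S.X '' Disk n) →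
    γ 0 ∈ S.X '' DiskBdry n →
    ∀ v : Euc (n+1), HasDerivWithinAt γ v (Set.Icc (-ε) 0) 0 →
      0 ≤ ⟪v, γ 0⟫)

/-- The surface area `|M|`, the `n`-dimensional Hausdorff measure of `M = X(𝔻)`. -/
def area (S : HypDisk n) : ℝ := (μH[n] (S.X '' Disk n)).toReal

/-- The boundary area `|∂M|`, the `(n-1)`-dimensional Hausdorff measure of `∂M = X(∂𝔻)`. -/
def bdryArea (S : HypDisk n) : ℝ := (μH[(n : ℝ) - 1] (S.X '' DiskBdry n)).toReal

/-- The surface integral `∫_M f dμ`, computed parametrically by the area formula. -/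
def surfIntegral (S : HypDisk n) (f : Euc n → ℝ) : ℝ :=
  ∫ x in Disk n, f x * Real.sqrt (gmet S x).det

/-- `ω_n`, the volume of the `n`-dimensional unit ball. -/
def ballVol (n : ℕ) : ℝ := (volume (Metric.closedBall (0 : Euc n) 1)).toReal

/-- `|S^{n-1}|`, the `(n-1)`-dimensional measure of the unit sphere in `ℝ^n`. -/
def sphereArea (n : ℕ) : ℝ := (μH[(n : ℝ) - 1] (Metric.sphere (0 : Euc n) 1)).toReal

/-- An equator of the sphere `S^m ⊂ ℝ^{m+1}`: the intersection of the unit sphere with a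
hyperplane through the origin. -/
def IsEquator {m : ℕ} (s : Set (Euc m)) : Prop :=
  ∃ v : Euc m, v ≠ 0 ∧ s = {y ∈ Metric.sphere (0 : Euc m) 1 | ⟪y, v⟫ = 0}

/-- A smooth solution of the inverse mean curvature flow `∂X/∂t = N/H` on `[0, T)` with free
boundary on the sphere `S^n`: each time slice is a hypersurface perpendicular to `S^n` from
the inside. -/
structure IMCFSol (n : ℕ) (T : ℝ) where
  M : ℝ → HypDisk n
  T_pos : 0 < T
  perp : ∀ t ∈ Set.Ico (0 : ℝ) T, PerpFromInside (M t)
  H_pos : ∀ t ∈ Set.Ico (0 : ℝ) T, ∀ x ∈ Disk n, 0 < meanCurv (M t) x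
  smooth : ContDiffOn ℝ (⊤ : ℕ∞) (fun p : ℝ × Euc n => (M p.1).X p.2)
    (Set.Ico (0 : ℝ) T ×ˢ Disk n)
  evol : ∀ t ∈ Set.Ico (0 : ℝ) T, ∀ x ∈ Disk n,
    HasDerivWithinAt (fun s => (M s).X x) ((meanCurv (M t) x)⁻¹ • (M t).N x)
      (Set.Ico (0 : ℝ) T) t

/-- The solution on `[0, T)` is maximal: no solution with the same initial embedding exists on
a longer time interval. -/
def IMCFSol.IsMaximal {n : ℕ} {T : ℝ} (sol : IMCFSol n T) : Prop :=
  ∀ (T' : ℝ) (sol' : IMCFSol n T'), (sol'.M 0).X = (sol.M 0).X → T' ≤ T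

/-- A smooth solution of the mean curvature flow `∂F/∂t = -H·N` on `[0, T)` with free boundary
on the sphere `S^n`: each time slice is a hypersurface perpendicular to `S^n` from the inside. -/
structure MCFSol (n : ℕ) (T : ℝ) where
  M : ℝ → HypDisk n
  T_pos : 0 < T
  perp : ∀ t ∈ Set.Ico (0 : ℝ) T, PerpFromInside (M t)
  smooth : ContDiffOn ℝ (⊤ : ℕ∞) (fun p : ℝ × Euc n => (M p.1).X p.2)
    (Set.Ico (0 : ℝ) T ×ˢ Disk n)
  evol : ∀ t ∈ Set.Ico (0 : ℝ) T, ∀ x ∈ Disk n,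
    HasDerivWithinAt (fun s => (M s).X x) (-(meanCurv (M t) x) • (M t).N x)
      (Set.Ico (0 : ℝ) T) t


theorem hausdorffMeasure_image_le_of_edist_le {α Y Z : Type*} [EMetricSpace Y] [EMetricSpace Z]
    [MeasurableSpace Y] [BorelSpace Y] [MeasurableSpace Z] [BorelSpace Z]
    {f : α → Y} {g : α → Z} {s : Set α} {K : ℝ≥0} {d : ℝ} (hd : 0 ≤ d)
    (h : ∀ x ∈ s, ∀ y ∈ s, edist (f x) (f y) ≤ K * edist (g x) (g y)) :
    μH[d] (f '' s) ≤ (K : ℝ≥0∞) ^ d * μH[d] (g '' s) := by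
  rcases s.eq_empty_or_nonempty with rfl | ⟨x₀, hx₀⟩
  · simp
  have : Nonempty α := ⟨x₀⟩
  set φ : Z → α := Function.invFunOn g s with hφ
  have h1 : ∀ x ∈ s, φ (g x) ∈ s ∧ g (φ (g x)) = g x := fun x hx =>
    ⟨Function.invFunOn_mem ⟨x, hx, rfl⟩, Function.invFunOn_eq ⟨x, hx, rfl⟩⟩
  have h2 : f '' s = (f ∘ φ) '' (g '' s) := by
    rw [image_image]
    refine image_congr fun x hx => ?_
    have := h x hx _ (h1 x hx).1
    rw [(h1 x hx).2, edist_self, mul_zero] at this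
    exact edist_eq_zero.1 (le_antisymm this bot_le)
  rw [h2]
  refine LipschitzOnWith.hausdorffMeasure_image_le ?_ hd
  rintro _ ⟨x, hx, rfl⟩ _ ⟨y, hy, rfl⟩
  have := h _ (h1 x hx).1 _ (h1 y hy).1
  rwa [(h1 x hx).2, (h1 y hy).2] at this

theorem euclideanHausdorffMeasure_image_le_of_norm_le {α Y Z : Type*} [NormedAddCommGroup Y]
    [NormedAddCommGroup Z] [MeasurableSpace Y] [BorelSpace Y] [MeasurableSpace Z] [BorelSpace Z]
    {f : α → Y} {g : α → Z} {s : Set α} {K : ℝ} (hK : 0 ≤ K) (d : ℕ)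
    (h : ∀ x ∈ s, ∀ y ∈ s, ‖f x - f y‖ ≤ K * ‖g x - g y‖) :
    μHE[d] (f '' s) ≤ ENNReal.ofReal K ^ d * μHE[d] (g '' s) := by
  have := hausdorffMeasure_image_le_of_edist_le (f := f) (g := g) (s := s) (K := K.toNNReal)
    (d := d) (by positivity) (fun x hx y hy => by
      rw [edist_eq_enorm_sub, edist_eq_enorm_sub, ← ofReal_norm, ← ofReal_norm,
        ← ENNReal.ofReal, ← ENNReal.ofReal_mul hK]
      exact ENNReal.ofReal_le_ofReal (h x hx y hy))
  simp only [Measure.euclideanHausdorffMeasure_def, Measure.smul_apply]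
  rw [ENNReal.smul_def, ENNReal.smul_def, smul_eq_mul, smul_eq_mul, mul_left_comm]
  gcongr
  rwa [ENNReal.rpow_natCast] at this

theorem norm_le_mul_of_norm_sub_le {V : Type*} [NormedAddCommGroup V] {a b : V} {K : ℝ}
    (hK : 1 ≤ K) (h : ‖a - b‖ ≤ (1 - 1 / K) * ‖b‖) : ‖a‖ ≤ K * ‖b‖ ∧ ‖b‖ ≤ K * ‖a‖ := by
  have hK0 : 0 < K := by linarith
  have hb := norm_nonneg b
  constructor
  · have h1 : ‖a‖ ≤ ‖a - b‖ + ‖b‖ := by simpa using norm_add_le (a - b) b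
    have h2 : 2 - 1 / K ≤ K := by
      have : 2 - 1 / K - K = -((K - 1) ^ 2 / K) := by field_simp; ring
      have : 0 ≤ (K - 1) ^ 2 / K := by positivity
      linarith
    nlinarith
  · have h1 : ‖b‖ ≤ ‖a - b‖ + ‖a‖ := by
      have := norm_sub_le a (a - b)
      simp at this; linarith
    have h2 : 1 / K * ‖b‖ ≤ ‖a‖ := by nlinarith
    rw [div_mul_eq_mul_div, one_mul, div_le_iff₀ hK0] at h2
    linarith

theorem measure_le_of_locally_le {α : Type*} [TopologicalSpace α] [SecondCountableTopology α]
    [MeasurableSpace α] [OpensMeasurableSpace α] {ν κ : Measure α} {c : ℝ≥0∞}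
    (h : ∀ x, ∃ U ∈ nhds x, ∀ A ⊆ U, MeasurableSet A → ν A ≤ c * κ A) : ν ≤ c • κ := by
  choose U hU hUA using h
  obtain ⟨t, htc, ht⟩ := TopologicalSpace.countable_cover_nhds (fun x => interior_mem_nhds.2 (hU x))
  refine Measure.le_iff.2 fun s hs => ?_
  rcases t.eq_empty_or_nonempty with rfl | hne
  · have : IsEmpty α := univ_eq_empty_iff.1 (by simpa using ht.symm)
    simp [eq_empty_of_isEmpty s]
  obtain ⟨e, rfl⟩ := htc.exists_eq_range hne
  rw [biUnion_range] at ht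
  set D := disjointed fun n => interior (U (e n)) with hD
  have hDm : ∀ n, MeasurableSet (D n) := fun n =>
    .disjointed (fun _ => isOpen_interior.measurableSet) n
  have hs' : s = ⋃ n, s ∩ D n := by
    rw [← inter_iUnion, iUnion_disjointed, ht, inter_univ]
  have hdisj : Pairwise (Function.onFun Disjoint fun n => s ∩ D n) := fun i j hij =>
    (disjoint_disjointed _ hij).mono inter_subset_right inter_subset_right
  have hsum : ∀ μ : Measure α, μ s = ∑' n, μ (s ∩ D n) := fun μ => by
    conv_lhs => rw [hs']
    exact measure_iUnion hdisj fun n => hs.inter (hDm n)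
  rw [Measure.smul_apply, smul_eq_mul, hsum ν, hsum κ, ← ENNReal.tsum_mul_left]
  refine ENNReal.tsum_le_tsum fun n => hUA (e n) _ ?_ (hs.inter (hDm n))
  exact inter_subset_right.trans ((disjointed_subset _ n).trans interior_subset)

theorem measure_le_of_locally_le_pow {α : Type*} [TopologicalSpace α] [SecondCountableTopology α]
    [MeasurableSpace α] [OpensMeasurableSpace α] {ν κ : Measure α} (m : ℕ)
    (h : ∀ K : ℝ, 1 < K → ∀ x, ∃ U ∈ nhds x, ∀ A ⊆ U, MeasurableSet A →
      ν A ≤ ENNReal.ofReal K ^ m * κ A) : ν ≤ κ := by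
  refine Measure.le_iff.2 fun s _ => ?_
  have h1 : ∀ K : ℝ, 1 < K → ν s ≤ ENNReal.ofReal K ^ m * κ s := fun K hK => by
    simpa using measure_le_of_locally_le (h K hK) s
  rcases eq_or_ne (κ s) ∞ with hs | hs
  · simp [hs]
  have h2 : Tendsto (fun K : ℝ => ENNReal.ofReal K ^ m * κ s) (nhdsWithin 1 (Ioi 1))
      (nhds (ENNReal.ofReal 1 ^ m * κ s)) := by
    refine ENNReal.Tendsto.mul_const ?_ (Or.inr hs)
    exact ((ENNReal.continuous_pow m).comp ENNReal.continuous_ofReal).continuousAt.tendsto.mono_left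
      nhdsWithin_le_nhds
  simp only [ENNReal.ofReal_one, one_pow, one_mul] at h2
  exact ge_of_tendsto h2 (eventually_mem_nhdsWithin.mono fun K hK => h1 K hK)

section SphereLocal

variable {E F : Type*} [NormedAddCommGroup E] [InnerProductSpace ℝ E]
  [NormedAddCommGroup F] [InnerProductSpace ℝ F]

theorem coe_orthogonalProjectionOnto_orthogonal_span_singleton {θ : E} (hθ : ‖θ‖ = 1) (v : E) :
    ((ℝ ∙ θ)ᗮ.orthogonalProjectionOnto v : E) = v - ⟪θ, v⟫ • θ := by
  have h := Submodule.starProjection_orthogonal_val (K := ℝ ∙ θ) v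
  rw [Submodule.starProjection_unit_singleton ℝ hθ] at h
  simpa using h

/-- The isometry `(t, r) ↦ t + r θ` from `θᗮ × ℝ`, for a unit vector `θ`. -/
def unitFrame (θ : E) (hθ : ‖θ‖ = 1) : WithLp 2 ((ℝ ∙ θ)ᗮ × ℝ) →ₗᵢ[ℝ] E where
  toFun z := (z.fst : E) + z.snd • θ
  map_add' z z' := by simp; module
  map_smul' c z := by simp; module
  norm_map' z := by
    have h : ⟪(z.fst : E), θ⟫ = 0 := by
      rw [real_inner_comm]
      exact Submodule.mem_orthogonal_singleton_iff_inner_right.1 z.fst.2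
    have h2 : ‖(z.fst : E) + z.snd • θ‖ ^ 2 = ‖z‖ ^ 2 := by
      rw [WithLp.prod_norm_sq_eq_of_L2, norm_add_sq_real, inner_smul_right, h, norm_smul, hθ]
      simp
    exact (sq_eq_sq₀ (norm_nonneg _) (norm_nonneg _)).1 h2

theorem unitFrame_apply {θ : E} (hθ : ‖θ‖ = 1) (z : WithLp 2 ((ℝ ∙ θ)ᗮ × ℝ)) :
    unitFrame θ hθ z = (z.fst : E) + z.snd • θ := rfl

theorem abs_inner_sub_le_of_unit {θ x y : E} {ρ : ℝ} (hx : ‖x‖ = 1) (hy : ‖y‖ = 1)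
    (hxθ : ‖x - θ‖ < ρ) (hyθ : ‖y - θ‖ < ρ) : |⟪θ, x - y⟫| ≤ ρ * ‖x - y‖ := by
  have h0 : ⟪(1 / 2 : ℝ) • (x + y), x - y⟫ = 0 := by
    rw [inner_smul_left, real_inner_add_sub_eq_zero_iff x y |>.2 (by rw [hx, hy]), mul_zero]
  have h1 : ⟪θ, x - y⟫ = ⟪-((1 / 2 : ℝ) • ((x - θ) + (y - θ))), x - y⟫ := by
    have : -((1 / 2 : ℝ) • ((x - θ) + (y - θ))) = θ - (1 / 2 : ℝ) • (x + y) := by module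
    rw [this, inner_sub_left, h0, sub_zero]
  rw [h1]
  refine (abs_real_inner_le_norm _ _).trans ?_
  gcongr
  rw [norm_neg, norm_smul]
  have := norm_add_le (x - θ) (y - θ)
  norm_num
  linarith

theorem exists_norm_image_sub_comparable {θ : E} [FiniteDimensional ℝ E] (hθ : ‖θ‖ = 1) {f : E → F}
    {f' : E →L[ℝ] F} (hinj : Function.Injective f')
    (hf : ∀ η > 0, ∃ ρ > 0, ∀ x y : E, ‖x‖ = 1 → ‖y‖ = 1 → ‖x - θ‖ < ρ → ‖y - θ‖ < ρ →
      ‖f x - f y - f' (x - y)‖ ≤ η * ‖x - y‖) {K : ℝ} (hK : 1 < K) :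
    ∃ ρ > 0, ∀ x y : E, ‖x‖ = 1 → ‖y‖ = 1 → ‖x - θ‖ < ρ → ‖y - θ‖ < ρ →
      ‖f x - f y‖ ≤ K * ‖f' ((ℝ ∙ θ)ᗮ.orthogonalProjectionOnto x) -
        f' ((ℝ ∙ θ)ᗮ.orthogonalProjectionOnto y)‖ ∧
      ‖f' ((ℝ ∙ θ)ᗮ.orthogonalProjectionOnto x) - f' ((ℝ ∙ θ)ᗮ.orthogonalProjectionOnto y)‖ ≤
        K * ‖f x - f y‖ := by
  obtain ⟨C, hC0, hC⟩ := f'.toLinearMap.exists_antilipschitzWith (LinearMap.ker_eq_bot.2 hinj)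
  have hCv : ∀ v, ‖v‖ ≤ C * ‖f' v‖ := fun v => by
    simpa using hC.le_mul_dist v 0
  have hCpos : (0 : ℝ) < C := hC0
  set e : ℝ := 1 - 1 / K with he
  have he0 : 0 < e := by
    have : 1 / K < 1 := (div_lt_one (by linarith)).2 hK
    linarith
  obtain ⟨ρ₁, hρ₁, H⟩ := hf (e / (4 * C)) (by positivity)
  set ρ₂ : ℝ := e / (4 * C * (‖f'‖ + 1)) with hρ₂
  have hρ₂0 : 0 < ρ₂ := by positivity
  refine ⟨min ρ₁ (min (1 / 2) ρ₂), by positivity, fun x y hx hy hxθ hyθ => ?_⟩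
  simp only [lt_min_iff] at hxθ hyθ
  rw [← map_sub, ← Submodule.coe_sub, ← map_sub]
  set P : E := ((ℝ ∙ θ)ᗮ.orthogonalProjectionOnto (x - y) : E) with hP
  have hPe : x - y = P + ⟪θ, x - y⟫ • θ := by
    rw [hP, coe_orthogonalProjectionOnto_orthogonal_span_singleton hθ]; abel
  have h1 := abs_inner_sub_le_of_unit hx hy hxθ.2.1 hyθ.2.1
  have h2 := abs_inner_sub_le_of_unit hx hy hxθ.2.2 hyθ.2.2
  have h3 : ‖x - y‖ ≤ 2 * ‖P‖ := by
    have : ‖x - y‖ ≤ ‖P‖ + |⟪θ, x - y⟫| := by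
      conv_lhs => rw [hPe]
      refine (norm_add_le _ _).trans ?_
      rw [norm_smul, hθ, mul_one, Real.norm_eq_abs]
    linarith
  refine norm_le_mul_of_norm_sub_le hK.le ?_
  have h4 : f x - f y - f' P = (f x - f y - f' (x - y)) + ⟪θ, x - y⟫ • f' θ := by
    conv_rhs => rw [hPe]
    simp only [map_add, map_smul]
    rw [← hPe]; abel
  rw [h4]
  have h5 : ‖⟪θ, x - y⟫ • f' θ‖ ≤ e / (4 * C) * ‖x - y‖ := by
    rw [norm_smul, Real.norm_eq_abs]
    have h6 : ‖f' θ‖ ≤ ‖f'‖ + 1 := by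
      have := f'.le_opNorm θ
      rw [hθ] at this; linarith
    calc |⟪θ, x - y⟫| * ‖f' θ‖ ≤ (ρ₂ * ‖x - y‖) * (‖f'‖ + 1) := by gcongr
      _ = e / (4 * C) * ‖x - y‖ := by rw [hρ₂]; field_simp
  calc ‖(f x - f y - f' (x - y)) + ⟪θ, x - y⟫ • f' θ‖
      ≤ e / (4 * C) * ‖x - y‖ + e / (4 * C) * ‖x - y‖ :=
        (norm_add_le _ _).trans (add_le_add (H x y hx hy hxθ.1 hyθ.1) h5)
    _ ≤ e / (2 * C) * (2 * (C * ‖f' P‖)) := by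
        rw [← add_mul]
        have : e / (4 * C) + e / (4 * C) = e / (2 * C) := by field_simp; norm_num
        rw [this]
        have := hCv P
        gcongr
        linarith
    _ = e * ‖f' P‖ := by field_simp

theorem exists_norm_smul_sub_comparable {θ : E} (hθ : ‖θ‖ = 1) {K : ℝ} (hK : 1 < K) :
    ∃ ρ > 0, ∀ (x y : E) (r s : ℝ), ‖x‖ = 1 → ‖y‖ = 1 → ‖x - θ‖ < ρ → ‖y - θ‖ < ρ →
      |r - 1| < ρ → 
      ‖r • x - s • y‖ ≤ K * ‖WithLp.toLp 2 ((ℝ ∙ θ)ᗮ.orthogonalProjectionOnto x, r) -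
        WithLp.toLp 2 ((ℝ ∙ θ)ᗮ.orthogonalProjectionOnto y, s)‖ ∧
      ‖WithLp.toLp 2 ((ℝ ∙ θ)ᗮ.orthogonalProjectionOnto x, r) -
        WithLp.toLp 2 ((ℝ ∙ θ)ᗮ.orthogonalProjectionOnto y, s)‖ ≤ K * ‖r • x - s • y‖ := by
  set e : ℝ := 1 - 1 / K with he
  have he0 : 0 < e := by
    have : 1 / K < 1 := (div_lt_one (by linarith)).2 hK
    linarith
  refine ⟨min (1 / 2) (e / 5), by positivity, fun x y r s hx hy hxθ hyθ hr => ?_⟩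
  simp only [lt_min_iff] at hxθ hyθ hr
  set z : WithLp 2 ((ℝ ∙ θ)ᗮ × ℝ) := WithLp.toLp 2 ((ℝ ∙ θ)ᗮ.orthogonalProjectionOnto x, r) -
        WithLp.toLp 2 ((ℝ ∙ θ)ᗮ.orthogonalProjectionOnto y, s) with hz
  rw [← (unitFrame θ hθ).norm_map z]
  have hzn := (unitFrame θ hθ).norm_map z
  set b := unitFrame θ hθ z with hb
  set P : E := ((ℝ ∙ θ)ᗮ.orthogonalProjectionOnto (x - y) : E) with hP
  have hzf : (z.fst : E) = P := by simp [hz, hP]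
  have hzs : z.snd = r - s := by simp [hz]
  have hbe : b = P + (r - s) • θ := by rw [hb, unitFrame_apply, hzf, hzs]
  have hPe : P = (x - y) - ⟪θ, x - y⟫ • θ := by
    rw [hP, coe_orthogonalProjectionOnto_orthogonal_span_singleton hθ]
  have hsq : ‖b‖ ^ 2 = ‖P‖ ^ 2 + |r - s| ^ 2 := by
    rw [hzn, WithLp.prod_norm_sq_eq_of_L2, ← hzf, hzs, Real.norm_eq_abs]; simp
  have hPb : ‖P‖ ≤ ‖b‖ := by
    apply le_of_sq_le_sq _ (norm_nonneg _)
    nlinarith [sq_nonneg |r - s|]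
  have hrb : |r - s| ≤ ‖b‖ := by
    apply le_of_sq_le_sq _ (norm_nonneg _)
    nlinarith [sq_nonneg ‖P‖]
  have h1 := abs_inner_sub_le_of_unit hx hy hxθ.1 hyθ.1
  have h2 := abs_inner_sub_le_of_unit hx hy hxθ.2 hyθ.2
  have h3 : ‖x - y‖ ≤ 2 * ‖P‖ := by
    have : ‖x - y‖ ≤ ‖P‖ + |⟪θ, x - y⟫| := by
      have : x - y = P + ⟪θ, x - y⟫ • θ := by rw [hPe]; abel
      conv_lhs => rw [this]
      refine (norm_add_le _ _).trans ?_
      rw [norm_smul, hθ, mul_one, Real.norm_eq_abs]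
    linarith
  refine norm_le_mul_of_norm_sub_le hK.le ?_
  have h4 : r • x - s • y - b =
      (r - s) • (y - θ) + (r - 1) • (x - y) + ⟪θ, x - y⟫ • θ := by
    rw [hbe, hPe]; module
  rw [h4]
  refine (norm_add₃_le).trans ?_
  rw [norm_smul, norm_smul, norm_smul, hθ, Real.norm_eq_abs, Real.norm_eq_abs, Real.norm_eq_abs,
    mul_one]
  calc |r - s| * ‖y - θ‖ + |r - 1| * ‖x - y‖ + |⟪θ, x - y⟫|
      ≤ ‖b‖ * (e / 5) + (e / 5) * (2 * ‖b‖) + (e / 5) * (2 * ‖b‖) := by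
        have h5 : ‖x - y‖ ≤ 2 * ‖b‖ := by linarith
        refine add_le_add (add_le_add ?_ ?_) (h2.trans ?_)
        · exact mul_le_mul hrb hyθ.2.le (norm_nonneg _) (norm_nonneg _)
        · exact mul_le_mul hr.2.le h5 (norm_nonneg _) (by positivity)
        · gcongr
    _ = e * ‖b‖ := by ring

end SphereLocal

section SphereArea

variable {E F : Type*} [NormedAddCommGroup E] [InnerProductSpace ℝ E] [FiniteDimensional ℝ E]
  [MeasurableSpace E] [BorelSpace E]
  [NormedAddCommGroup F] [InnerProductSpace ℝ F] [MeasurableSpace F] [BorelSpace F]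

theorem volume_image_smul_sphere_Ioo {t : ℝ} (ht : 0 < t) {A : Set (sphere (0 : E) 1)}
    (hA : MeasurableSet A) :
    volume ((fun p : sphere (0 : E) 1 × ℝ => p.2 • (p.1 : E)) '' (A ×ˢ Ioo t 1)) =
      (volume : Measure E).toSphere A *
        Measure.volumeIoiPow (Module.finrank ℝ E - 1) (Subtype.val ⁻¹' Ioo t 1) := by
  have hmp := (volume : Measure E).measurePreserving_homeomorphUnitSphereProd
  have hm : MeasurableSet (Subtype.val ⁻¹' Ioo t 1 : Set (Ioi (0:ℝ))) :=
    measurable_subtype_coe measurableSet_Ioo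
  rw [← Measure.prod_prod, ← hmp.measure_preimage (hA.prod hm).nullMeasurableSet,
    (MeasurableEmbedding.subtype_coe (measurableSet_singleton (0 : E)).compl).comap_apply]
  congr 1
  rw [← (homeomorphUnitSphereProd E).image_symm, image_image]
  ext x
  constructor
  · rintro ⟨⟨a, r⟩, ⟨ha, hr⟩, rfl⟩
    exact ⟨(a, ⟨r, ht.trans hr.1⟩), ⟨ha, hr⟩, rfl⟩
  · rintro ⟨⟨a, r⟩, ⟨ha, hr⟩, rfl⟩
    exact ⟨(a, r), ⟨ha, hr⟩, rfl⟩

theorem volumeIoiPow_Ioo_bounds (d : ℕ) {t : ℝ} (ht : 0 < t) :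
    Measure.volumeIoiPow d (Subtype.val ⁻¹' Ioo t 1) ≤ ENNReal.ofReal (1 - t) ∧
    ENNReal.ofReal (t ^ d) * ENNReal.ofReal (1 - t) ≤
      Measure.volumeIoiPow d (Subtype.val ⁻¹' Ioo t 1) := by
  have hm : MeasurableSet (Subtype.val ⁻¹' Ioo t 1 : Set (Ioi (0:ℝ))) :=
    measurable_subtype_coe measurableSet_Ioo
  have hv : (Measure.comap Subtype.val volume : Measure (Ioi (0 : ℝ))) (Subtype.val ⁻¹' Ioo t 1) =
      ENNReal.ofReal (1 - t) := by
    rw [(MeasurableEmbedding.subtype_coe measurableSet_Ioi).comap_apply,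
      Subtype.image_preimage_coe, inter_eq_self_of_subset_right, Real.volume_Ioo]
    exact fun x hx => ht.trans hx.1
  rw [Measure.volumeIoiPow, withDensity_apply _ hm, ← hv]
  constructor
  · rw [← setLIntegral_one]
    refine setLIntegral_mono' hm fun r hr => ?_
    rw [← ENNReal.ofReal_one]
    exact ENNReal.ofReal_le_ofReal (pow_le_one₀ (ht.trans hr.1).le hr.2.le)
  · rw [← setLIntegral_const]
    refine setLIntegral_mono' hm fun r hr => ?_
    exact ENNReal.ofReal_le_ofReal (pow_le_pow_left₀ ht.le hr.1.le _)

theorem volume_image_toLp_prod {T : Type*} [NormedAddCommGroup T] [InnerProductSpace ℝ T]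
    [FiniteDimensional ℝ T] [MeasurableSpace T] [BorelSpace T] (B : Set T) (I : Set ℝ) :
    volume (WithLp.toLp 2 '' (B ×ˢ I) : Set (WithLp 2 (T × ℝ))) = volume B * volume I := by
  rw [← Measure.prod_prod, ← Measure.volume_eq_prod]
  have h := (WithLp.volume_preserving_toLp T ℝ).measure_preimage_emb
    (MeasurableEquiv.toLp 2 (T × ℝ)).measurableEmbedding (WithLp.toLp 2 '' (B ×ˢ I))
  rw [← h, preimage_image_eq _ (WithLp.toLp_injective 2)]

end SphereArea

section SphereArea

variable {E F : Type*} [NormedAddCommGroup E] [InnerProductSpace ℝ E] [FiniteDimensional ℝ E]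
  [MeasurableSpace E] [BorelSpace E]
  [NormedAddCommGroup F] [InnerProductSpace ℝ F] [MeasurableSpace F] [BorelSpace F]

theorem ENNReal.one_le_ofReal_mul_of_one_le {a b : ℝ} (ha : 0 ≤ a) (h : 1 ≤ a * b) :
    1 ≤ ENNReal.ofReal a * ENNReal.ofReal b := by
  rw [← ENNReal.ofReal_mul ha, ← ENNReal.ofReal_one]
  exact ENNReal.ofReal_le_ofReal h

theorem exists_nhds_volume_projection_comparable {d : ℕ} (hd : Module.finrank ℝ E = d + 1)
    (θ : sphere (0 : E) 1) {K : ℝ} (hK : 1 < K) :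
    ∃ ρ > 0, ∀ A ⊆ ball θ ρ, MeasurableSet A →
      (volume : Measure E).toSphere A ≤ ENNReal.ofReal K ^ (d + 2) *
        volume ((fun x : sphere (0 : E) 1 =>
          (ℝ ∙ (θ : E))ᗮ.orthogonalProjectionOnto (x : E)) '' A) ∧
      volume ((fun x : sphere (0 : E) 1 =>
          (ℝ ∙ (θ : E))ᗮ.orthogonalProjectionOnto (x : E)) '' A) ≤
        ENNReal.ofReal K ^ (d + 1) * (volume : Measure E).toSphere A := by
  have hθ : ‖(θ : E)‖ = 1 := norm_eq_of_mem_sphere θ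
  obtain ⟨ρ, hρ, H⟩ := exists_norm_smul_sub_comparable hθ hK
  obtain ⟨t, ht0, ht1, htρ, htK⟩ : ∃ t : ℝ, 0 < t ∧ t < 1 ∧ 1 - t < ρ ∧ 1 ≤ K * t ^ d := by
    have hc : ContinuousAt (fun t : ℝ => K * t ^ d) 1 := by fun_prop
    have h1 : ∀ᶠ t in nhds (1 : ℝ), 1 < K * t ^ d :=
      hc.eventually (lt_mem_nhds (by simpa using hK))
    have h2 : ∀ᶠ t in nhds (1 : ℝ), 0 < t := lt_mem_nhds one_pos
    have h3 : ∀ᶠ t in nhds (1 : ℝ), 1 - ρ < t := lt_mem_nhds (by linarith)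
    obtain ⟨t, ⟨h1, h2, h3⟩, h4⟩ :=
      (((h1.and (h2.and h3)).filter_mono nhdsWithin_le_nhds).and
        (self_mem_nhdsWithin : Iio (1:ℝ) ∈ nhdsWithin 1 (Iio 1))).exists
    exact ⟨t, h2, h4, by linarith, h1.le⟩
  refine ⟨ρ, hρ, fun A hA hAm => ?_⟩
  set p : sphere (0 : E) 1 → (ℝ ∙ (θ : E))ᗮ := fun x =>
    (ℝ ∙ (θ : E))ᗮ.orthogonalProjectionOnto (x : E) with hp
  have hT : Module.finrank ℝ (WithLp 2 ((ℝ ∙ (θ : E))ᗮ × ℝ)) = d + 1 := by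
    have : Fact (Module.finrank ℝ E = d + 1) := ⟨hd⟩
    rw [(WithLp.linearEquiv 2 ℝ ((ℝ ∙ (θ : E))ᗮ × ℝ)).finrank_eq, Module.finrank_prod,
      Submodule.finrank_orthogonal_span_singleton (n := d) (by
        rw [← norm_ne_zero_iff, hθ]; exact one_ne_zero), Module.finrank_self]
  have hvE : (μHE[d + 1] : Measure E) = volume := by
    rw [← hd, InnerProductSpace.euclideanHausdorffMeasure_eq_volume]
  have hvT : (μHE[d + 1] : Measure (WithLp 2 ((ℝ ∙ (θ : E))ᗮ × ℝ))) = volume := by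
    rw [← hT, InnerProductSpace.euclideanHausdorffMeasure_eq_volume]
  have hK0 : 0 ≤ K := by linarith
  have hloc : ∀ x ∈ A ×ˢ Ioo t 1, ∀ y ∈ A ×ˢ Ioo t 1,
      ‖x.2 • (x.1 : E) - y.2 • (y.1 : E)‖ ≤
        K * ‖WithLp.toLp 2 (p x.1, x.2) - WithLp.toLp 2 (p y.1, y.2)‖ ∧
      ‖WithLp.toLp 2 (p x.1, x.2) - WithLp.toLp 2 (p y.1, y.2)‖ ≤
        K * ‖x.2 • (x.1 : E) - y.2 • (y.1 : E)‖ := by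
    rintro ⟨x, r⟩ ⟨hx, hr⟩ ⟨y, s⟩ ⟨hy, hs⟩
    refine H x y r s (norm_eq_of_mem_sphere x) (norm_eq_of_mem_sphere y) ?_ ?_ ?_
    · simpa [dist_eq_norm, Subtype.dist_eq] using hA hx
    · simpa [dist_eq_norm, Subtype.dist_eq] using hA hy
    · rw [abs_lt]; constructor <;> linarith [hr.1, hr.2]
  have e1 := euclideanHausdorffMeasure_image_le_of_norm_le hK0 (d + 1)
    (fun x hx y hy => (hloc x hx y hy).1)
  have e2 := euclideanHausdorffMeasure_image_le_of_norm_le hK0 (d + 1)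
    (fun x hx y hy => (hloc x hx y hy).2)
  have himg : (fun x : sphere (0 : E) 1 × ℝ => WithLp.toLp 2 (p x.1, x.2)) '' (A ×ˢ Ioo t 1) =
      WithLp.toLp 2 '' ((p '' A) ×ˢ Ioo t 1) := by
    ext z
    constructor
    · rintro ⟨⟨x, r⟩, ⟨hx, hr⟩, rfl⟩
      exact ⟨(p x, r), ⟨mem_image_of_mem p hx, hr⟩, rfl⟩
    · rintro ⟨⟨_, r⟩, ⟨⟨x, hx, rfl⟩, hr⟩, rfl⟩
      exact ⟨(x, r), ⟨hx, hr⟩, rfl⟩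
  rw [himg, hvE, hvT, volume_image_smul_sphere_Ioo ht0 hAm, volume_image_toLp_prod,
    Real.volume_Ioo, hd, Nat.add_sub_cancel] at e1 e2
  obtain ⟨v1, v2⟩ := volumeIoiPow_Ioo_bounds d ht0
  set a := (volume : Measure E).toSphere A
  set b := volume (p '' A)
  set v := Measure.volumeIoiPow d (Subtype.val ⁻¹' Ioo t 1)
  set s := ENNReal.ofReal (1 - t) with hs
  have hs0 : s ≠ 0 := by simp [hs, ht1]
  have hsT : s ≠ ∞ := by simp [hs]
  set k := ENNReal.ofReal K with hk
  have htK' : 1 ≤ k * ENNReal.ofReal (t ^ d) := ENNReal.one_le_ofReal_mul_of_one_le hK0 htK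
  constructor
  · rw [← ENNReal.mul_le_mul_iff_left hs0 hsT]
    calc a * s ≤ a * ((k * ENNReal.ofReal (t ^ d)) * s) := by
          gcongr; exact le_mul_of_one_le_left bot_le htK'
      _ = k * (a * (ENNReal.ofReal (t ^ d) * s)) := by ring
      _ ≤ k * (k ^ (d + 1) * (b * s)) := by
          refine mul_le_mul_right ?_ k
          exact le_trans (by gcongr) e1
      _ = k ^ (d + 2) * b * s := by ring
  · rw [← ENNReal.mul_le_mul_iff_left hs0 hsT]
    calc b * s ≤ k ^ (d + 1) * (a * v) := e2
      _ ≤ k ^ (d + 1) * (a * s) := by gcongr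
      _ = k ^ (d + 1) * a * s := by ring

theorem exists_nhds_euclideanHausdorffMeasure_image_comparable {d : ℕ}
    (hd : Module.finrank ℝ E = d + 1) (θ : sphere (0 : E) 1) {f : E → F} {f' : E →L[ℝ] F}
    (hinj : Function.Injective f')
    (hf : ∀ η > 0, ∃ ρ > 0, ∀ x y : E, ‖x‖ = 1 → ‖y‖ = 1 → ‖x - θ‖ < ρ → ‖y - θ‖ < ρ →
      ‖f x - f y - f' (x - y)‖ ≤ η * ‖x - y‖) {K : ℝ} (hK : 1 < K) :
    ∃ ρ > 0, ∀ A ⊆ ball θ ρ, MeasurableSet A →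
      μHE[d] ((fun x : sphere (0 : E) 1 => f x) '' A) ≤ ENNReal.ofReal K ^ (2 * d + 2) *
        (ENNReal.ofReal (f'.toLinearMap ∘ₗ (ℝ ∙ (θ : E))ᗮ.subtype).normDet *
          (volume : Measure E).toSphere A) ∧
      ENNReal.ofReal (f'.toLinearMap ∘ₗ (ℝ ∙ (θ : E))ᗮ.subtype).normDet *
          (volume : Measure E).toSphere A ≤
        ENNReal.ofReal K ^ (2 * d + 2) * μHE[d] ((fun x : sphere (0 : E) 1 => f x) '' A) := by
  have hθ : ‖(θ : E)‖ = 1 := norm_eq_of_mem_sphere θ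
  have hT : Module.finrank ℝ (ℝ ∙ (θ : E))ᗮ = d := by
    have : Fact (Module.finrank ℝ E = d + 1) := ⟨hd⟩
    exact Submodule.finrank_orthogonal_span_singleton (n := d) (by
        rw [← norm_ne_zero_iff, hθ]; exact one_ne_zero)
  obtain ⟨ρ₁, hρ₁, H1⟩ := exists_nhds_volume_projection_comparable hd θ hK
  obtain ⟨ρ₂, hρ₂, H2⟩ := exists_norm_image_sub_comparable hθ hinj hf hK
  refine ⟨min ρ₁ ρ₂, lt_min hρ₁ hρ₂, fun A hA hAm => ?_⟩
  obtain ⟨a1, a2⟩ := H1 A (hA.trans (ball_subset_ball (min_le_left _ _))) hAm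
  have hK0 : 0 ≤ K := by linarith
  have hloc : ∀ x ∈ A, ∀ y ∈ A, _ := fun x hx y hy =>
    H2 x y (norm_eq_of_mem_sphere x) (norm_eq_of_mem_sphere y)
      (by simpa [dist_eq_norm, Subtype.dist_eq] using
        ball_subset_ball (min_le_right _ _) (hA hx))
      (by simpa [dist_eq_norm, Subtype.dist_eq] using
        ball_subset_ball (min_le_right _ _) (hA hy))
  have e1 := euclideanHausdorffMeasure_image_le_of_norm_le
    (f := fun x : sphere (0 : E) 1 => f x) (g := fun x : sphere (0 : E) 1 =>
      f' ((ℝ ∙ (θ : E))ᗮ.orthogonalProjectionOnto (x : E))) hK0 d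
    (fun x hx y hy => (hloc x hx y hy).1)
  have e2 := euclideanHausdorffMeasure_image_le_of_norm_le
    (f := fun x : sphere (0 : E) 1 => f' ((ℝ ∙ (θ : E))ᗮ.orthogonalProjectionOnto (x : E)))
    (g := fun x : sphere (0 : E) 1 => f x) hK0 d
    (fun x hx y hy => (hloc x hx y hy).2)
  have himg : μHE[d] ((fun x : sphere (0 : E) 1 =>
      f' ((ℝ ∙ (θ : E))ᗮ.orthogonalProjectionOnto (x : E))) '' A) =
      ENNReal.ofReal (f'.toLinearMap ∘ₗ (ℝ ∙ (θ : E))ᗮ.subtype).normDet *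
        volume ((fun x : sphere (0 : E) 1 =>
          (ℝ ∙ (θ : E))ᗮ.orthogonalProjectionOnto (x : E)) '' A) := by
    rw [← LinearMap.euclideanHausdorffMeasure_image_eq_normDet_mul_volume, hT, image_image]
    rfl
  rw [himg] at e1 e2
  set a := (volume : Measure E).toSphere A
  set b := volume ((fun x : sphere (0 : E) 1 =>
    (ℝ ∙ (θ : E))ᗮ.orthogonalProjectionOnto (x : E)) '' A)
  set J := ENNReal.ofReal (f'.toLinearMap ∘ₗ (ℝ ∙ (θ : E))ᗮ.subtype).normDet
  set k := ENNReal.ofReal K with hk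
  have hk1 : 1 ≤ k := by
    rw [hk, ← ENNReal.ofReal_one]; exact ENNReal.ofReal_le_ofReal hK.le
  constructor
  · calc μHE[d] ((fun x : sphere (0 : E) 1 => f x) '' A) ≤ k ^ d * (J * b) := e1
      _ ≤ k ^ d * (J * (k ^ (d + 1) * a)) := by gcongr
      _ = k ^ (2 * d + 1) * (J * a) := by ring
      _ ≤ k ^ (2 * d + 2) * (J * a) :=
        mul_le_mul_left (pow_le_pow_right₀ hk1 (by omega)) _
  · calc J * a ≤ J * (k ^ (d + 2) * b) := mul_le_mul_right a1 J
      _ = k ^ (d + 2) * (J * b) := by ring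
      _ ≤ k ^ (d + 2) * (k ^ d * μHE[d] ((fun x : sphere (0 : E) 1 => f x) '' A)) :=
        mul_le_mul_right e2 _
      _ = _ := by ring

/-- The area formula for a map of the unit sphere. -/
theorem comap_euclideanHausdorffMeasure_sphere {d : ℕ} (hd : Module.finrank ℝ E = d + 1)
    {f : E → F} {f' : E → E →L[ℝ] F} {j : sphere (0 : E) 1 → ℝ}
    (hemb : MeasurableEmbedding (fun x : sphere (0 : E) 1 => f x))
    (hinj : ∀ θ : sphere (0 : E) 1, Function.Injective (f' θ))
    (hf : ∀ θ : sphere (0 : E) 1, ∀ η > 0, ∃ ρ > 0, ∀ x y : E, ‖x‖ = 1 → ‖y‖ = 1 →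
      ‖x - θ‖ < ρ → ‖y - θ‖ < ρ → ‖f x - f y - f' θ (x - y)‖ ≤ η * ‖x - y‖)
    (hjc : Continuous j) (hj0 : ∀ θ, 0 < j θ)
    (hj : ∀ θ : sphere (0 : E) 1,
      ((f' θ).toLinearMap ∘ₗ (ℝ ∙ (θ : E))ᗮ.subtype).normDet = j θ) :
    (μHE[d] : Measure F).comap (fun x : sphere (0 : E) 1 => f x) =
      (volume : Measure E).toSphere.withDensity (fun θ => ENNReal.ofReal (j θ)) := by
  have key : ∀ K : ℝ, 1 < K → ∀ θ : sphere (0 : E) 1, ∃ U ∈ nhds θ, ∀ A ⊆ U, MeasurableSet A →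
      μHE[d] ((fun x : sphere (0 : E) 1 => f x) '' A) ≤ ENNReal.ofReal K ^ (2 * d + 3) *
        (volume : Measure E).toSphere.withDensity (fun θ => ENNReal.ofReal (j θ)) A ∧
      (volume : Measure E).toSphere.withDensity (fun θ => ENNReal.ofReal (j θ)) A ≤
        ENNReal.ofReal K ^ (2 * d + 3) * μHE[d] ((fun x : sphere (0 : E) 1 => f x) '' A) := by
    intro K hK θ
    have hK0 : 0 ≤ K := by linarith
    obtain ⟨ρ, hρ, H⟩ :=
      exists_nhds_euclideanHausdorffMeasure_image_comparable hd θ (hinj θ) (hf θ) hK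
    have h1 : ∀ᶠ x in nhds θ, j x < K * j θ :=
      hjc.continuousAt.eventually (gt_mem_nhds (by nlinarith [hj0 θ]))
    have h2 : ∀ᶠ x in nhds θ, j θ < K * j x :=
      (hjc.const_mul K).continuousAt.eventually (lt_mem_nhds (by nlinarith [hj0 θ]))
    refine ⟨ball θ ρ ∩ {x | j x < K * j θ ∧ j θ < K * j x},
      inter_mem (ball_mem_nhds _ hρ) (h1.and h2), fun A hA hAm => ?_⟩
    obtain ⟨a1, a2⟩ := H A (hA.trans inter_subset_left) hAm
    rw [hj θ] at a1 a2
    have b1 : ENNReal.ofReal (j θ) * (volume : Measure E).toSphere A ≤ ENNReal.ofReal K *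
        (volume : Measure E).toSphere.withDensity (fun θ => ENNReal.ofReal (j θ)) A := by
      rw [withDensity_apply _ hAm, ← setLIntegral_const,
        ← lintegral_const_mul _ (by fun_prop)]
      refine setLIntegral_mono' hAm fun x hx => ?_
      rw [← ENNReal.ofReal_mul hK0]
      exact ENNReal.ofReal_le_ofReal (hA hx).2.2.le
    have b2 : (volume : Measure E).toSphere.withDensity (fun θ => ENNReal.ofReal (j θ)) A ≤
        ENNReal.ofReal K * (ENNReal.ofReal (j θ) * (volume : Measure E).toSphere A) := by
      rw [withDensity_apply _ hAm, ← mul_assoc, ← setLIntegral_const]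
      refine setLIntegral_mono' hAm fun x hx => ?_
      rw [← ENNReal.ofReal_mul hK0]
      exact ENNReal.ofReal_le_ofReal (hA hx).2.1.le
    constructor
    · refine a1.trans ?_
      rw [pow_succ _ (2 * d + 2), mul_assoc]
      gcongr
    · refine b2.trans ?_
      rw [pow_succ' _ (2 * d + 2), mul_assoc]
      gcongr
  refine le_antisymm ?_ ?_
  · refine measure_le_of_locally_le_pow (2 * d + 3) fun K hK θ => ?_
    obtain ⟨U, hU, H⟩ := key K hK θ
    refine ⟨U, hU, fun A hA hAm => ?_⟩
    rw [hemb.comap_apply]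
    exact (H A hA hAm).1
  · refine measure_le_of_locally_le_pow (2 * d + 3) fun K hK θ => ?_
    obtain ⟨U, hU, H⟩ := key K hK θ
    refine ⟨U, hU, fun A hA hAm => ?_⟩
    rw [hemb.comap_apply]
    exact (H A hA hAm).2

end SphereArea

section Polar

variable {E : Type*} [NormedAddCommGroup E] [InnerProductSpace ℝ E] [FiniteDimensional ℝ E]
  [MeasurableSpace E] [BorelSpace E]

theorem integral_mul_fun_norm [Nontrivial E] (h : E → ℝ) (k : ℝ → ℝ) :
    ∫ x : E, h (‖x‖⁻¹ • x) * k ‖x‖ = (∫ θ, h θ ∂(volume : Measure E).toSphere) *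
      ∫ r : Ioi (0 : ℝ), k r ∂Measure.volumeIoiPow (Module.finrank ℝ E - 1) := by
  calc ∫ x : E, h (‖x‖⁻¹ • x) * k ‖x‖
      = ∫ x : ({(0)}ᶜ : Set E), h (‖x.1‖⁻¹ • x.1) * k ‖x.1‖
        ∂(volume.comap Subtype.val) := by
        rw [integral_subtype_comap (measurableSet_singleton _).compl
          fun x ↦ h (‖x‖⁻¹ • x) * k ‖x‖, restrict_compl_singleton]
    _ = ∫ x : sphere (0 : E) 1 × Ioi (0 : ℝ), h x.1 * k x.2 ∂(volume : Measure E).toSphere.prod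
        (.volumeIoiPow (Module.finrank ℝ E - 1)) := by
      simpa using (volume : Measure E).measurePreserving_homeomorphUnitSphereProd.integral_comp
        (Homeomorph.measurableEmbedding _) (fun x : sphere (0 : E) 1 × Ioi (0 : ℝ) => h x.1 * k x.2)
    _ = _ := integral_prod_mul (fun θ : sphere (0 : E) 1 => h θ) (fun r : Ioi (0 : ℝ) => k r)

theorem setIntegral_shell_comp_normalize [Nontrivial E] (h : E → ℝ) (t : ℝ) :
    ∫ x in {x : E | ‖x‖ ∈ Ioo t 1}, h (‖x‖⁻¹ • x) =
      (∫ θ, h θ ∂(volume : Measure E).toSphere) *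
        (Measure.volumeIoiPow (Module.finrank ℝ E - 1)).real (Subtype.val ⁻¹' Ioo t 1) := by
  have hm : MeasurableSet (Subtype.val ⁻¹' Ioo t 1 : Set (Ioi (0:ℝ))) :=
    measurable_subtype_coe measurableSet_Ioo
  have := integral_mul_fun_norm h ((Ioo t 1).indicator 1)
  have h1 : (fun x : E => h (‖x‖⁻¹ • x) * (Ioo t 1).indicator 1 ‖x‖) =
      {x : E | ‖x‖ ∈ Ioo t 1}.indicator fun x => h (‖x‖⁻¹ • x) := by
    ext x
    by_cases hx : ‖x‖ ∈ Ioo t 1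
    · rw [indicator_of_mem hx, indicator_of_mem (show x ∈ {x : E | ‖x‖ ∈ Ioo t 1} from hx)]
      simp
    · rw [indicator_of_notMem hx, indicator_of_notMem (show x ∉ {x : E | ‖x‖ ∈ Ioo t 1} from hx)]
      simp
  rw [h1, integral_indicator (show MeasurableSet {x : E | ‖x‖ ∈ Ioo t 1} from
    measurable_norm measurableSet_Ioo)] at this
  rw [← integral_indicator_one hm]
  exact this

theorem volumeIoiPow_real_Ioo_bounds (d : ℕ) {t : ℝ} (ht : 0 < t) (ht1 : t < 1) :
    (Measure.volumeIoiPow d).real (Subtype.val ⁻¹' Ioo t 1) ≤ 1 - t ∧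
    t ^ d * (1 - t) ≤ (Measure.volumeIoiPow d).real (Subtype.val ⁻¹' Ioo t 1) := by
  obtain ⟨h1, h2⟩ := volumeIoiPow_Ioo_bounds d ht
  have hfin := h1.trans_lt ENNReal.ofReal_lt_top
  refine ⟨ENNReal.toReal_le_of_le_ofReal (by linarith) h1, ?_⟩
  rw [← ENNReal.ofReal_mul (by positivity)] at h2
  exact (ENNReal.ofReal_le_iff_le_toReal hfin.ne).1 h2

theorem volume_real_shell_le [Nontrivial E] {t : ℝ} (ht : 0 < t) (ht1 : t < 1) :
    (volume : Measure E).real {x : E | ‖x‖ ∈ Ioo t 1} ≤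
      (volume : Measure E).toSphere.real univ * (1 - t) := by
  have := setIntegral_shell_comp_normalize (E := E) (fun _ => 1) t
  simp only [integral_const, smul_eq_mul, mul_one, measureReal_restrict_apply_univ] at this
  rw [this]
  gcongr
  exact (volumeIoiPow_real_Ioo_bounds _ ht ht1).1

/-- Averages over thin shells inside the unit sphere converge to the spherical integral. -/
theorem tendsto_setIntegral_shell [Nontrivial E] {h : E → ℝ} {C : ℝ}
    (hc : ContinuousOn h (closedBall 0 1 \ {0}))
    (hC : ∀ x : E, x ≠ 0 → ‖x‖ ≤ 1 → |h x - h (‖x‖⁻¹ • x)| ≤ C * (1 - ‖x‖)) :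
    Tendsto (fun ε : ℝ => ε⁻¹ * ∫ x in {x : E | ‖x‖ ∈ Ioo (1 - ε) 1}, h x)
      (nhdsWithin 0 (Ioi 0)) (nhds (∫ θ, h θ ∂(volume : Measure E).toSphere)) := by
  set I := ∫ θ, h θ ∂(volume : Measure E).toSphere with hI
  set d := Module.finrank ℝ E - 1 with hd
  set m : ℝ → ℝ := fun ε => (Measure.volumeIoiPow d).real (Subtype.val ⁻¹' Ioo (1 - ε) 1) with hm
  set s := (volume : Measure E).toSphere.real univ with hs
  have hsmall : ∀ᶠ ε in nhdsWithin (0 : ℝ) (Ioi 0), 0 < ε ∧ ε < 1 := by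
    filter_upwards [self_mem_nhdsWithin, nhdsWithin_le_nhds (gt_mem_nhds one_pos)] with ε h1 h2
    exact ⟨h1, h2⟩
  have hmlim : Tendsto (fun ε => ε⁻¹ * m ε) (nhdsWithin 0 (Ioi 0)) (nhds 1) := by
    have h1 : Tendsto (fun ε : ℝ => (1 - ε) ^ d) (nhdsWithin 0 (Ioi 0)) (nhds 1) := by
      have : Tendsto (fun ε : ℝ => (1 - ε) ^ d) (nhds 0) (nhds ((1 - 0) ^ d)) :=
        ContinuousAt.tendsto (by fun_prop)
      simpa using this.mono_left nhdsWithin_le_nhds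
    refine tendsto_of_tendsto_of_tendsto_of_le_of_le' h1 tendsto_const_nhds ?_ ?_
    · filter_upwards [hsmall] with ε ⟨h0, h1⟩
      have := (volumeIoiPow_real_Ioo_bounds d (t := 1 - ε) (by linarith) (by linarith)).2
      rw [le_inv_mul_iff₀ h0]
      simp only [hm]; linarith
    · filter_upwards [hsmall] with ε ⟨h0, h1⟩
      have := (volumeIoiPow_real_Ioo_bounds d (t := 1 - ε) (by linarith) (by linarith)).1
      rw [inv_mul_le_iff₀ h0]
      simp only [hm]; linarith
  have hdiff : Tendsto (fun ε : ℝ => ε⁻¹ * (∫ x in {x : E | ‖x‖ ∈ Ioo (1 - ε) 1}, h x) -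
      ε⁻¹ * m ε * I) (nhdsWithin 0 (Ioi 0)) (nhds 0) := by
    have hlim : Tendsto (fun ε : ℝ => C * s * ε) (nhdsWithin 0 (Ioi 0)) (nhds 0) := by
      have : Tendsto (fun ε : ℝ => C * s * ε) (nhds 0) (nhds (C * s * 0)) :=
        ContinuousAt.tendsto (by fun_prop)
      simpa using this.mono_left nhdsWithin_le_nhds
    refine squeeze_zero_norm' ?_ hlim
    filter_upwards [hsmall] with ε ⟨h0, h1⟩
    set A := {x : E | ‖x‖ ∈ Ioo (1 - ε) 1} with hA
    have hAm : MeasurableSet A := measurable_norm measurableSet_Ioo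
    set B := {x : E | ‖x‖ ∈ Icc (1 - ε) 1} with hB
    have hAB : A ⊆ B := fun x hx => ⟨hx.1.le, hx.2.le⟩
    have hBc : IsCompact B := by
      refine (isCompact_closedBall (0 : E) 1).of_isClosed_subset
        (isClosed_Icc.preimage continuous_norm) fun x hx => ?_
      simpa using hx.2
    have hB0 : ∀ x ∈ B, x ≠ 0 := by
      rintro _ hx rfl
      have := hx.1
      simp at this; linarith
    have hBn : ∀ x ∈ B, x ∈ closedBall (0 : E) 1 \ {0} := fun x hx =>
      ⟨by simpa using hx.2, by simpa using hB0 x hx⟩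
    have hnorm : ContinuousOn (fun x : E => ‖x‖⁻¹ • x) B := by
      refine ContinuousOn.smul (continuousOn_id.norm.inv₀ fun x hx => ?_) continuousOn_id
      exact norm_ne_zero_iff.2 (hB0 x hx)
    have i1 : IntegrableOn h A :=
      ((hc.mono hBn).integrableOn_compact hBc).mono_set hAB
    have i2 : IntegrableOn (fun x => h (‖x‖⁻¹ • x)) A := by
      refine IntegrableOn.mono_set (ContinuousOn.integrableOn_compact hBc ?_) hAB
      refine hc.comp hnorm fun x hx => ?_
      have := norm_ne_zero_iff.2 (hB0 x hx)
      constructor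
      · simp [norm_smul, this]
      · simp [hB0 x hx]
    have e1 := setIntegral_shell_comp_normalize h (1 - ε)
    have e2 : ε⁻¹ * (∫ x in A, h x) - ε⁻¹ * m ε * I =
        ε⁻¹ * ∫ x in A, (h x - h (‖x‖⁻¹ • x)) := by
      rw [integral_sub i1 i2, e1]; ring
    rw [e2, norm_mul, norm_inv, Real.norm_of_nonneg h0.le, inv_mul_le_iff₀ h0]
    have hC0 : 0 ≤ C := by
      obtain ⟨x, hx⟩ := exists_norm_eq E (show (0 : ℝ) ≤ 1 / 2 by norm_num)
      have := (abs_nonneg _).trans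
        (hC x (norm_ne_zero_iff.1 (by rw [hx]; norm_num)) (by rw [hx]; norm_num))
      rw [hx] at this
      linarith
    have b1 : ‖∫ x in A, (h x - h (‖x‖⁻¹ • x))‖ ≤ C * ε * (volume : Measure E).real A := by
      refine norm_setIntegral_le_of_norm_le_const ?_ fun x hx => ?_
      · exact (measure_mono hAB).trans_lt hBc.measure_lt_top
      · refine (hC x (hB0 x (hAB hx)) hx.2.le).trans ?_
        have := hx.1
        gcongr
        linarith
    have b2 : (volume : Measure E).real A ≤ s * ε := by
      have := volume_real_shell_le (E := E) (t := 1 - ε) (by linarith) (by linarith)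
      rwa [sub_sub_cancel] at this
    calc _ ≤ C * ε * (volume : Measure E).real A := b1
      _ ≤ C * ε * (s * ε) := by gcongr
      _ = _ := by ring
  have := hdiff.add (hmlim.mul_const I)
  simpa using this

end Polar

section BallCutoff

variable {E : Type*} [NormedAddCommGroup E]

/-- A piecewise linear radial cutoff, equal to `1` on the ball of radius `1 - ε` and
to `0` outside of the unit ball. -/
def ballCutoff (ε : ℝ) (x : E) : ℝ := max 0 (min 1 (ε⁻¹ * (1 - ‖x‖)))

theorem ballCutoff_mem_Icc (ε : ℝ) (x : E) : ballCutoff ε x ∈ Icc (0 : ℝ) 1 :=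
  ⟨le_max_left _ _, max_le zero_le_one (min_le_left _ _)⟩

theorem ballCutoff_eq_one {ε : ℝ} (hε : 0 < ε) {x : E} (hx : ‖x‖ ≤ 1 - ε) :
    ballCutoff ε x = 1 := by
  have : 1 ≤ ε⁻¹ * (1 - ‖x‖) := by
    rw [le_inv_mul_iff₀ hε]; linarith
  rw [ballCutoff, min_eq_left this, max_eq_right zero_le_one]

theorem ballCutoff_eq_zero {ε : ℝ} (hε : 0 < ε) {x : E} (hx : 1 ≤ ‖x‖) :
    ballCutoff ε x = 0 := by
  have : ε⁻¹ * (1 - ‖x‖) ≤ 0 :=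
    mul_nonpos_of_nonneg_of_nonpos (by positivity) (by linarith)
  rw [ballCutoff, max_eq_left ((min_le_right _ _).trans this)]

theorem ballCutoff_eq_of_mem {ε : ℝ} (hε : 0 < ε) {x : E} (hx : ‖x‖ ∈ Icc (1 - ε) 1) :
    ballCutoff ε x = ε⁻¹ * (1 - ‖x‖) := by
  have h1 : ε⁻¹ * (1 - ‖x‖) ≤ 1 := by
    rw [inv_mul_le_iff₀ hε]; linarith [hx.1]
  have h0 : 0 ≤ ε⁻¹ * (1 - ‖x‖) := mul_nonneg (by positivity) (by linarith [hx.2])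
  rw [ballCutoff, min_eq_right h1, max_eq_right h0]

theorem lipschitzWith_ballCutoff (ε : ℝ) : ∃ C, LipschitzWith C (ballCutoff ε : E → ℝ) := by
  have h : LipschitzWith (‖ε⁻¹‖₊ * 1) (fun x : E => ε⁻¹ * (1 - ‖x‖)) := by
    refine (lipschitzWith_smul ε⁻¹).comp ?_
    have := (LipschitzWith.const (1 : ℝ)).sub (lipschitzWith_one_norm (E := E))
    simpa using this
  exact ⟨_, (h.const_min 1).const_max 0⟩

variable [InnerProductSpace ℝ E]

theorem hasCompactSupport_ballCutoff [FiniteDimensional ℝ E] {ε : ℝ} (hε : 0 < ε) :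
    HasCompactSupport (ballCutoff ε : E → ℝ) := by
  refine HasCompactSupport.intro (isCompact_closedBall (0 : E) 1) fun x hx => ?_
  refine ballCutoff_eq_zero hε ?_
  simp at hx; exact hx.le

theorem lineDeriv_ballCutoff {ε : ℝ} (hε : 0 < ε) (hε1 : ε < 1) {x : E} (h1 : ‖x‖ ≠ 1)
    (h2 : ‖x‖ ≠ 1 - ε) (v : E) :
    lineDeriv ℝ (ballCutoff ε) x v =
      {x : E | ‖x‖ ∈ Ioo (1 - ε) 1}.indicator (fun x => -(ε⁻¹ * ⟪‖x‖⁻¹ • x, v⟫)) x := by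
  rcases lt_or_gt_of_ne h2 with h | h
  · have hx : x ∉ {x : E | ‖x‖ ∈ Ioo (1 - ε) 1} := fun hx => absurd hx.1 (not_lt.2 h.le)
    rw [indicator_of_notMem hx]
    have : ballCutoff ε =ᶠ[nhds x] fun _ => (1 : ℝ) := by
      filter_upwards [continuous_norm.continuousAt.eventually (gt_mem_nhds h)] with y hy
      exact ballCutoff_eq_one hε hy.le
    rw [this.lineDeriv_eq]
    simp [lineDeriv]
  rcases lt_or_gt_of_ne h1 with h' | h'
  · have hx : x ∈ {x : E | ‖x‖ ∈ Ioo (1 - ε) 1} := ⟨h, h'⟩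
    rw [indicator_of_mem hx]
    have : ballCutoff ε =ᶠ[nhds x] fun y => ε⁻¹ * (1 - ‖y‖) := by
      filter_upwards [continuous_norm.continuousAt.eventually (Ioo_mem_nhds h h')] with y hy
      exact ballCutoff_eq_of_mem hε ⟨hy.1.le, hy.2.le⟩
    rw [this.lineDeriv_eq]
    have hx0 : x ≠ 0 := by
      rintro rfl; simp at h; linarith
    have hd : HasFDerivAt (fun y : E => ‖y‖) (‖x‖⁻¹ • innerSL ℝ x) x := by
      have h3 := (HasFDerivAt.norm_sq (hasFDerivAt_id x)).sqrt (by simpa using hx0)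
      simp only [id, Real.sqrt_sq (norm_nonneg _)] at h3
      convert h3 using 1
      ext v
      simp
      field_simp
    have := ((hd.const_sub 1).const_mul ε⁻¹).hasLineDerivAt v
    rw [this.lineDeriv]
    simp [inner_smul_left]
  · have hx : x ∉ {x : E | ‖x‖ ∈ Ioo (1 - ε) 1} := fun hx => absurd hx.2 (not_lt.2 h'.le)
    rw [indicator_of_notMem hx]
    have : ballCutoff ε =ᶠ[nhds x] fun _ => (0 : ℝ) := by
      filter_upwards [continuous_norm.continuousAt.eventually (lt_mem_nhds h')] with y hy
      exact ballCutoff_eq_zero hε hy.le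
    rw [this.lineDeriv_eq]
    simp [lineDeriv]

end BallCutoff

section Divergence

variable {n : ℕ}

/-- Integration by parts against the radial cutoff. -/
theorem integral_fderiv_mul_ballCutoff {u : Euc n → ℝ}
    (hu : ContDiffOn ℝ 1 u (closedBall 0 1)) {ε : ℝ} (hε : 0 < ε) (hε1 : ε < 1)
    (hn : 0 < n) (v : Euc n) :
    ∫ x in ball 0 1, fderiv ℝ u x v * ballCutoff ε x =
      ε⁻¹ * ∫ x in {x : Euc n | ‖x‖ ∈ Ioo (1 - ε) 1},
        ⟪‖x‖⁻¹ • x, v⟫ * u x := by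
  have : Nonempty (Fin n) := ⟨⟨0, hn⟩⟩
  have hcvx := convex_closedBall (0 : Euc n) 1
  obtain ⟨C, hC⟩ : ∃ C, LipschitzOnWith C u (closedBall 0 1) := by
    refine LocallyLipschitzOn.exists_lipschitzOnWith_of_compact (isCompact_closedBall _ _) ?_
    intro x hx
    obtain ⟨K, t, ht, hK⟩ := (hu x hx).exists_lipschitzOnWith hcvx
    exact ⟨K, t, ht, hK⟩
  obtain ⟨w, hw, hwu⟩ := hC.extend_real
  obtain ⟨D, hD⟩ := lipschitzWith_ballCutoff (E := Euc n) ε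
  have key := hw.integral_lineDeriv_mul_eq (μ := volume) hD (hasCompactSupport_ballCutoff hε) v
  have hA : MeasurableSet {x : Euc n | ‖x‖ ∈ Ioo (1 - ε) 1} := measurable_norm measurableSet_Ioo
  have h1 : (fun x => lineDeriv ℝ w x v * ballCutoff ε x) =
      (ball (0 : Euc n) 1).indicator (fun x => fderiv ℝ u x v * ballCutoff ε x) := by
    ext x
    by_cases hx : x ∈ ball (0 : Euc n) 1
    · rw [indicator_of_mem hx]
      have hmem : closedBall (0 : Euc n) 1 ∈ nhds x :=
        mem_of_superset (isOpen_ball.mem_nhds hx) ball_subset_closedBall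
      have hd : DifferentiableAt ℝ u x :=
        ((hu x (ball_subset_closedBall hx)).contDiffAt hmem).differentiableAt one_ne_zero
      have he : w =ᶠ[nhds x] u := by
        filter_upwards [hmem] with y hy using (hwu hy).symm
      rw [he.lineDeriv_eq, hd.lineDeriv_eq_fderiv]
    · rw [indicator_of_notMem hx, ballCutoff_eq_zero hε (by simpa using hx), mul_zero]
  have h2 : (fun x => lineDeriv ℝ (ballCutoff ε) x (-v) * w x) =ᵐ[volume]
      {x : Euc n | ‖x‖ ∈ Ioo (1 - ε) 1}.indicator (fun x => ε⁻¹ * (⟪‖x‖⁻¹ • x, v⟫ * u x)) := by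
    have hs : ∀ r : ℝ, ∀ᵐ x : Euc n, ‖x‖ ≠ r := fun r => by
      rw [ae_iff]
      simpa [sphere, dist_eq_norm] using Measure.addHaar_sphere (volume : Measure (Euc n)) 0 r
    filter_upwards [hs 1, hs (1 - ε)] with x hx1 hx2
    rw [lineDeriv_ballCutoff hε hε1 hx1 hx2]
    by_cases hx : x ∈ {x : Euc n | ‖x‖ ∈ Ioo (1 - ε) 1}
    · rw [indicator_of_mem hx, indicator_of_mem hx, inner_neg_right,
        hwu (show x ∈ closedBall (0 : Euc n) 1 by simpa using hx.2.le)]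
      ring
    · rw [indicator_of_notMem hx, indicator_of_notMem hx, zero_mul]
  rw [h1, integral_congr_ae h2, integral_indicator measurableSet_ball, integral_indicator hA,
    integral_const_mul] at key
  exact key

/-- The divergence theorem on the closed unit ball. -/
theorem integral_divergence_ball (hn : 0 < n)
    {V : Euc n → Euc n}
    (hV : ContDiffOn ℝ 1 V (closedBall 0 1)) {D : Euc n → ℝ}
    (hD : ContinuousOn D (closedBall 0 1))
    (hDV : ∀ x ∈ ball 0 1, D x = ∑ i, fderiv ℝ (fun y => V y i) x (EuclideanSpace.single i 1)) :
    ∫ x in closedBall 0 1, D x =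
      ∫ θ : sphere (0 : Euc n) 1, ⟪V θ, θ⟫
        ∂(volume : Measure (Euc n)).toSphere := by
  have : Nonempty (Fin n) := ⟨⟨0, hn⟩⟩
  have hVi : ∀ i, ContDiffOn ℝ 1 (fun y => V y i) (closedBall (0 : Euc n) 1) :=
    fun i => (contDiffOn_euclidean.1 hV) i
  have hDint : IntegrableOn D (closedBall (0 : Euc n) 1) :=
    hD.integrableOn_compact (isCompact_closedBall _ _)
  have hae : ball (0 : Euc n) 1 =ᵐ[volume] closedBall (0 : Euc n) 1 := by
    refine (ae_eq_set.2 ⟨?_, ?_⟩)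
    · rw [sdiff_eq_empty.2 ball_subset_closedBall]; simp
    · rw [closedBall_sdiff_ball]; exact Measure.addHaar_sphere _ _ _
  set h : Euc n → ℝ := fun x => ⟪V x, ‖x‖⁻¹ • x⟫ with hh
  have hcont : ContinuousOn h (closedBall 0 1 \ {0}) := by
    have h1 : ContinuousOn (fun x : Euc n => ‖x‖⁻¹ • x) (closedBall 0 1 \ {0}) := by
      refine ContinuousOn.smul (continuousOn_id.norm.inv₀ fun x hx => ?_) continuousOn_id
      exact norm_ne_zero_iff.2 hx.2
    exact (hV.continuousOn.mono sdiff_subset).inner h1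
  have hsmall : ∀ᶠ ε in nhdsWithin (0 : ℝ) (Ioi 0), 0 < ε ∧ ε < 1 := by
    filter_upwards [self_mem_nhdsWithin, nhdsWithin_le_nhds (gt_mem_nhds one_pos)] with ε h1 h2
    exact ⟨h1, h2⟩
  obtain ⟨C, hC⟩ : ∃ C, LipschitzOnWith C V (closedBall 0 1) := by
    refine LocallyLipschitzOn.exists_lipschitzOnWith_of_compact (isCompact_closedBall _ _) ?_
    intro x hx
    obtain ⟨K, t, ht, hK⟩ := (hV x hx).exists_lipschitzOnWith (convex_closedBall (0 : Euc n) 1)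
    exact ⟨K, t, ht, hK⟩
  have hlim1 := tendsto_setIntegral_shell (C := C) hcont (fun x hx0 hx1 => by
    have hx : ‖x‖ ≠ 0 := norm_ne_zero_iff.2 hx0
    have hnn : ‖‖x‖⁻¹ • x‖ = 1 := by
      rw [norm_smul, norm_inv, norm_norm, inv_mul_cancel₀ hx]
    have e : h x - h (‖x‖⁻¹ • x) = ⟪V x - V (‖x‖⁻¹ • x), ‖x‖⁻¹ • x⟫ := by
      simp only [hh, hnn, inv_one, one_smul, inner_sub_left]
    have e2 : ‖x - ‖x‖⁻¹ • x‖ = 1 - ‖x‖ := by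
      have : x - ‖x‖⁻¹ • x = -((1 - ‖x‖) • (‖x‖⁻¹ • x)) := by
        rw [sub_smul, smul_smul ‖x‖, mul_inv_cancel₀ hx]; module
      rw [this, norm_neg, norm_smul, hnn, mul_one, Real.norm_of_nonneg (by linarith)]
    rw [e, ← e2]
    refine (abs_real_inner_le_norm _ _).trans ?_
    rw [hnn, mul_one]
    exact hC.norm_sub_le (by simpa using hx1) (by simp [hnn]))
  have hsph : (fun θ : sphere (0 : Euc n) 1 => h θ) = fun θ : sphere (0 : Euc n) 1 => ⟪V θ, θ⟫ := by
    ext θ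
    simp [hh]
  rw [hsph] at hlim1
  have hlim2 : Tendsto (fun ε : ℝ => ∫ x in ball (0 : Euc n) 1, D x * ballCutoff ε x)
      (nhdsWithin 0 (Ioi 0)) (nhds (∫ x in ball (0 : Euc n) 1, D x)) := by
    refine tendsto_integral_filter_of_dominated_convergence (fun x => ‖D x‖) ?_ ?_ ?_ ?_
    · refine Eventually.of_forall fun ε => ?_
      obtain ⟨c, hc⟩ := lipschitzWith_ballCutoff (E := Euc n) ε
      exact (hDint.mono_set ball_subset_closedBall).aestronglyMeasurable.mul
        hc.continuous.aestronglyMeasurable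
    · refine Eventually.of_forall fun ε => Eventually.of_forall fun x => ?_
      obtain ⟨h0, h1⟩ := ballCutoff_mem_Icc ε x
      rw [norm_mul, Real.norm_of_nonneg h0]
      exact mul_le_of_le_one_right (norm_nonneg _) h1
    · exact (hDint.mono_set ball_subset_closedBall).norm
    · refine (ae_restrict_mem measurableSet_ball).mono fun x hx => ?_
      have hx' : 0 < 1 - ‖x‖ := by simpa using hx
      refine tendsto_const_nhds.congr' ?_
      filter_upwards [hsmall, nhdsWithin_le_nhds (gt_mem_nhds hx')] with ε h1 h2
      rw [ballCutoff_eq_one h1.1 (by linarith), mul_one]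
  have heq : ∀ᶠ ε in nhdsWithin (0 : ℝ) (Ioi 0),
      ε⁻¹ * (∫ x in {x : Euc n | ‖x‖ ∈ Ioo (1 - ε) 1}, h x) =
        ∫ x in ball (0 : Euc n) 1, D x * ballCutoff ε x := by
    filter_upwards [hsmall] with ε ⟨h0, h1⟩
    have hi1 : ∀ i ∈ Finset.univ, IntegrableOn
        (fun x => fderiv ℝ (fun y => V y i) x (EuclideanSpace.single i 1) * ballCutoff ε x)
        (ball (0 : Euc n) 1) := fun i _ => by
      obtain ⟨c, hc⟩ := lipschitzWith_ballCutoff (E := Euc n) ε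
      have hu : UniqueDiffOn ℝ (closedBall (0 : Euc n) 1) :=
        uniqueDiffOn_convex (convex_closedBall _ _)
          ⟨0, ball_subset_interior_closedBall (mem_ball_self one_pos)⟩
      have hcd : ContinuousOn (fun x => fderivWithin ℝ (fun y => V y i) (closedBall 0 1) x
          (EuclideanSpace.single i 1) * ballCutoff ε x) (closedBall (0 : Euc n) 1) :=
        (((hVi i).continuousOn_fderivWithin hu le_rfl).clm_apply continuousOn_const).mul
          hc.continuous.continuousOn
      refine ((hcd.integrableOn_compact (isCompact_closedBall _ _)).mono_set
        ball_subset_closedBall).congr_fun (fun x hx => ?_) measurableSet_ball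
      simp only
      rw [fderivWithin_of_mem_nhds (mem_of_superset (isOpen_ball.mem_nhds hx)
        ball_subset_closedBall)]
    have hi2 : ∀ i ∈ Finset.univ, IntegrableOn
        (fun x => ⟪‖x‖⁻¹ • x, EuclideanSpace.single i 1⟫ * V x i)
        {x : Euc n | ‖x‖ ∈ Ioo (1 - ε) 1} := fun i _ => by
      have hann : IsCompact {x : Euc n | ‖x‖ ∈ Icc (1 - ε) 1} := by
        refine (isCompact_closedBall (0 : Euc n) 1).of_isClosed_subset
          (isClosed_Icc.preimage continuous_norm) fun x hx => by simpa using hx.2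
      have h1 : ContinuousOn (fun x : Euc n => ‖x‖⁻¹ • x) {x : Euc n | ‖x‖ ∈ Icc (1 - ε) 1} := by
        refine ContinuousOn.smul (continuousOn_id.norm.inv₀ fun x hx => ?_) continuousOn_id
        have : 1 - ε ≤ ‖x‖ := hx.1
        exact ne_of_gt (by simp only [id]; linarith)
      refine (ContinuousOn.integrableOn_compact hann ?_).mono_set fun x hx => ⟨hx.1.le, hx.2.le⟩
      exact (h1.inner continuousOn_const).mul
        ((hVi i).continuousOn.mono fun x hx => by simpa using hx.2)
    calc ε⁻¹ * (∫ x in {x : Euc n | ‖x‖ ∈ Ioo (1 - ε) 1}, h x)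
        = ε⁻¹ * ∫ x in {x : Euc n | ‖x‖ ∈ Ioo (1 - ε) 1},
            ∑ i, ⟪‖x‖⁻¹ • x, EuclideanSpace.single i 1⟫ * V x i := by
          congr 2
          ext x
          simp only [hh, PiLp.inner_apply]
          simp [mul_comm]
      _ = ∑ i, ∫ x in ball (0 : Euc n) 1,
            fderiv ℝ (fun y => V y i) x (EuclideanSpace.single i 1) * ballCutoff ε x := by
          rw [integral_finsetSum _ hi2, Finset.mul_sum]
          exact Finset.sum_congr rfl fun i _ =>
            (integral_fderiv_mul_ballCutoff (hVi i) h0 h1 hn _).symm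
      _ = ∫ x in ball (0 : Euc n) 1, D x * ballCutoff ε x := by
          rw [← integral_finsetSum _ hi1]
          refine setIntegral_congr_fun measurableSet_ball fun x hx => ?_
          simp only [hDV x hx, Finset.sum_mul]
  rw [← setIntegral_congr_set hae]
  exact tendsto_nhds_unique hlim2 (hlim1.congr' heq)

end Divergence

section MatrixCalculus

variable {E F m : Type*} [NormedAddCommGroup E] [NormedSpace ℝ E] [Fintype m] [DecidableEq m]
  [NormedAddCommGroup F] [InnerProductSpace ℝ F]

/-- Jacobi's formula. -/
theorem hasFDerivAt_matrix_det {M : E → Matrix m m ℝ} {M' : m → m → E →L[ℝ] ℝ} {x : E}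
    (h : ∀ i j, HasFDerivAt (fun y => M y i j) (M' i j) x) :
    HasFDerivAt (fun y => (M y).det) (∑ i, ∑ j, (M x).adjugate j i • M' i j) x := by
  let f : ContinuousMultilinearMap ℝ (fun _ : m => m → ℝ) ℝ :=
    { toMultilinearMap := (Matrix.detRowAlternating (n := m) (R := ℝ)).toMultilinearMap
      cont := Continuous.matrix_det (A := fun M : Matrix m m ℝ => M) continuous_id }
  have hr : ∀ i, HasFDerivAt (fun y => M y i) (ContinuousLinearMap.pi (M' i)) x :=
    fun i => hasFDerivAt_pi.2 (h i)
  refine (HasFDerivAt.multilinear_comp f hr).congr_fderiv ?_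
  ext v
  simp only [sum_apply, ContinuousLinearMap.comp_apply,
    smul_apply, smul_eq_mul]
  refine Finset.sum_congr rfl fun i _ => ?_
  change ((M x).updateRow i fun j => M' i j v).det = _
  rw [← Matrix.cramer_transpose_apply, Matrix.cramer_eq_adjugate_mulVec,
    ← Matrix.adjugate_transpose]
  rfl

theorem ContDiffOn.matrix_det {M : E → Matrix m m ℝ} {s : Set E} {k : WithTop ℕ∞}
    (h : ∀ i j, ContDiffOn ℝ k (fun y => M y i j) s) :
    ContDiffOn ℝ k (fun y => (M y).det) s := by
  simp only [Matrix.det_apply]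
  exact ContDiffOn.sum fun σ _ => (contDiffOn_prod fun i _ => h _ _).const_smul _

theorem ContDiffOn.matrix_inv {M : E → Matrix m m ℝ} {s : Set E} {k : WithTop ℕ∞}
    (h : ∀ i j, ContDiffOn ℝ k (fun y => M y i j) s) (h0 : ∀ y ∈ s, (M y).det ≠ 0) (i j : m) :
    ContDiffOn ℝ k (fun y => (M y)⁻¹ i j) s := by
  simp only [Matrix.inv_def, Matrix.smul_apply, smul_eq_mul, Ring.inverse_eq_inv',
    Matrix.adjugate_apply]
  refine ((ContDiffOn.matrix_det h).inv h0).mul (ContDiffOn.matrix_det fun a b => ?_)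
  by_cases hj : a = j
  · subst hj
    simpa using contDiffOn_const
  · simpa [Matrix.updateRow_ne hj] using h a b

/-- The divergence of `√det g · g⁻¹ w` for `w i = ⟪B i, e₀⟫`, where `g` is the Gram matrix of a
frame `B` with symmetric derivatives. -/
theorem sum_fderiv_sqrt_det_mul {B : m → E → F} {B' : m → E →L[ℝ] F} {x : E}
    (hB : ∀ i, HasFDerivAt (B i) (B' i) x) {e : m → E} (hsymm : ∀ i j, B' i (e j) = B' j (e i))
    {g : E → Matrix m m ℝ} (hg : ∀ y i j, g y i j = ⟪B i y, B j y⟫) (hdet : 0 < (g x).det)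
    {e₀ ν : F} {c : ℝ} {W : E → m → ℝ} {W' : m → E →L[ℝ] ℝ}
    (hW' : ∀ i, HasFDerivAt (fun y => W y i) (W' i) x)
    (hW : ∀ᶠ y in nhds x, ∀ a, ∑ b, g y a b * W y b = ⟪B a y, e₀⟫)
    (he₀ : e₀ = ∑ b, W x b • B b x + c • ν) :
    ∑ i, fderiv ℝ (fun y => √(g y).det * W y i) x (e i) =
      √(g x).det * (c * ∑ i, ∑ a, (g x)⁻¹ i a * ⟪B' a (e i), ν⟫) := by
  have hGsymm : ∀ i j, (g x)⁻¹ i j = (g x)⁻¹ j i := by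
    have ht : (g x).transpose = g x := by
      ext i j
      simp [hg, real_inner_comm]
    intro i j
    conv_lhs => rw [← ht, ← Matrix.transpose_nonsing_inv]
    rfl
  have hg' : ∀ i j, HasFDerivAt (fun y => g y i j)
      (fderivInnerCLM ℝ (B i x, B j x) ∘L (B' i).prod (B' j)) x := fun i j => by
    simpa only [hg] using (hB i).inner ℝ (hB j)
  have hs := (hasFDerivAt_matrix_det hg').sqrt hdet.ne'
  set s := √(g x).det with hsdef
  have hs0 : 0 < s := Real.sqrt_pos.2 hdet
  have hs2 : (g x).det = s * s := (Real.mul_self_sqrt hdet.le).symm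
  set G := (g x)⁻¹ with hG
  have hadj : ∀ i j, (g x).adjugate i j = s * s * G i j := fun i j => by
    rw [hG, Matrix.inv_def, Matrix.smul_apply, smul_eq_mul, Ring.inverse_eq_inv', ← hs2,
      mul_inv_cancel_left₀ hdet.ne']
  set Γ : m → m → m → ℝ := fun a i b => ⟪B' a (e i), B b x⟫ with hΓ
  have hΓs : ∀ a i b, Γ a i b = Γ i a b := fun a i b => by simp only [hΓ, hsymm a i]
  have hder : ∀ i, HasFDerivAt (fun y => √(g y).det * W y i) _ x := fun i => hs.mul (hW' i)
  have hlin : ∀ i a, ∑ b, (g x a b * W' b (e i) + W x b * (Γ a i b + Γ b i a)) =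
      ⟪B' a (e i), e₀⟫ := fun i a => by
    have h1 : HasFDerivAt (fun y => ∑ b, g y a b * W y b) _ x :=
      HasFDerivAt.fun_sum fun b _ => (hg' a b).mul (hW' b)
    have h2 := (h1.congr_of_eventuallyEq (hW.mono fun y hy => (hy a).symm)).unique
      ((hB a).inner ℝ (hasFDerivAt_const e₀ x))
    have h3 := DFunLike.congr_fun h2 (e i)
    simp [fderivInnerCLM_apply] at h3
    rw [← h3]
    refine Finset.sum_congr rfl fun b _ => ?_
    simp only [hΓ]
    rw [real_inner_comm (B' b (e i)) (B a x)]
    ring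
  have hsol : ∀ i, W' i (e i) =
      ∑ a, G i a * (⟪B' a (e i), e₀⟫ - ∑ b, W x b * (Γ a i b + Γ b i a)) := fun i => by
    have h1 : (g x).mulVec (fun b => W' b (e i)) =
        fun a => ⟪B' a (e i), e₀⟫ - ∑ b, W x b * (Γ a i b + Γ b i a) := by
      ext a
      rw [← hlin i a, Finset.sum_add_distrib, add_sub_cancel_right]
      rfl
    have h2 := congrArg (fun v => G.mulVec v) h1
    simp only [Matrix.mulVec_mulVec, hG, Matrix.nonsing_inv_mul _ (isUnit_iff_ne_zero.2 hdet.ne'),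
      Matrix.one_mulVec] at h2
    exact congrFun h2 i
  have hT : ∀ a i, ⟪B' a (e i), e₀⟫ = ∑ b, W x b * Γ a i b + c * ⟪B' a (e i), ν⟫ := fun a i => by
    conv_lhs => rw [he₀]
    simp only [inner_add_right, inner_sum, inner_smul_right, hΓ]
  have hterm : ∀ i, fderiv ℝ (fun y => √(g y).det * W y i) x (e i) =
      s * (∑ a, G i a * (c * ⟪B' a (e i), ν⟫)) +
        s * (∑ a, ∑ b, G a b * Γ a i b * W x i - ∑ a, ∑ b, G i a * (Γ b i a * W x b)) := fun i => by
    have hdd : (∑ a, ∑ b, (g x).adjugate b a * (⟪B a x, B' b (e i)⟫ + ⟪B' a (e i), B b x⟫)) =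
        2 * (s * s) * ∑ a, ∑ b, G a b * Γ a i b := by
      have h1 : ∑ a, ∑ b, G b a * Γ b i a = ∑ a, ∑ b, G a b * Γ a i b := Finset.sum_comm
      have h2 : ∑ a, ∑ b, G b a * Γ a i b = ∑ a, ∑ b, G a b * Γ a i b :=
        Finset.sum_congr rfl fun a _ => Finset.sum_congr rfl fun b _ => by rw [hGsymm]
      rw [two_mul, add_mul]
      conv_rhs => enter [1]; rw [← h1]
      conv_rhs => enter [2]; rw [← h2]
      simp only [Finset.mul_sum, ← Finset.sum_add_distrib]
      refine Finset.sum_congr rfl fun a _ => Finset.sum_congr rfl fun b _ => ?_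
      rw [hadj, real_inner_comm (B' b (e i)) (B a x)]
      simp only [hΓ]
      ring
    have hs' : (1 / (2 * s)) * (2 * (s * s) * ∑ a, ∑ b, G a b * Γ a i b) =
        s * ∑ a, ∑ b, G a b * Γ a i b := by
      field_simp
    rw [(hder i).fderiv]
    simp only [add_apply, smul_apply, smul_eq_mul, hsol, sum_apply,
      ContinuousLinearMap.comp_apply, ContinuousLinearMap.prod_apply, fderivInnerCLM_apply]
    rw [hdd, hs', mul_left_comm, ← mul_add, ← mul_add]
    congr 1
    simp only [hT, Finset.mul_sum, ← Finset.sum_add_distrib, ← Finset.sum_sub_distrib]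
    refine Finset.sum_congr rfl fun a _ => ?_
    have h1 : ∑ b, W x b * (Γ a i b + Γ b i a) =
        ∑ b, W x b * Γ a i b + ∑ b, W x b * Γ b i a := by
      rw [← Finset.sum_add_distrib]
      exact Finset.sum_congr rfl fun b _ => mul_add _ _ _
    have h2 : ∑ b, (G a b * Γ a i b * W x i - G i a * (Γ b i a * W x b)) =
        ∑ b, W x i * (G a b * Γ a i b) - G i a * ∑ b, W x b * Γ b i a := by
      rw [Finset.mul_sum, ← Finset.sum_sub_distrib]
      exact Finset.sum_congr rfl fun b _ => by ring
    rw [h1, h2]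
    ring
  have hcancel : ∑ i, ∑ a, ∑ b, G a b * Γ a i b * W x i =
      ∑ i, ∑ a, ∑ b, G i a * (Γ b i a * W x b) := by
    rw [Finset.sum_comm]
    refine Finset.sum_congr rfl fun a _ => ?_
    rw [Finset.sum_comm]
    refine Finset.sum_congr rfl fun b _ => Finset.sum_congr rfl fun i _ => ?_
    rw [hΓs a i b]
    ring
  rw [Finset.sum_congr rfl fun i _ => hterm i, Finset.sum_add_distrib, ← Finset.mul_sum,
    ← Finset.mul_sum, Finset.sum_sub_distrib, hcancel, sub_self, mul_zero, add_zero]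
  simp only [Finset.mul_sum]
  refine Finset.sum_congr rfl fun i _ => Finset.sum_congr rfl fun a _ => ?_
  ring

end MatrixCalculus

section Geometry

variable {n : ℕ}

theorem uniqueDiffOn_disk : UniqueDiffOn ℝ (Disk n) :=
  uniqueDiffOn_convex (convex_closedBall _ _)
    ⟨0, ball_subset_interior_closedBall (mem_ball_self one_pos)⟩

theorem ball_subset_disk : ball (0 : Euc n) 1 ⊆ Disk n := ball_subset_closedBall

theorem disk_mem_nhds {x : Euc n} (hx : x ∈ ball (0 : Euc n) 1) : Disk n ∈ nhds x :=
  mem_of_superset (isOpen_ball.mem_nhds hx) ball_subset_disk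

theorem euc_sum_smul_single (v : Euc n) : ∑ i, v i • EuclideanSpace.single i (1 : ℝ) = v := by
  simpa using (EuclideanSpace.basisFun (Fin n) ℝ).sum_repr v

/-- An injective linear map into a hyperplane of the codimension one space is onto it. -/
theorem exists_eq_of_inner_eq_zero {A : Euc n →L[ℝ] Euc (n + 1)} (hA : Function.Injective A)
    {ν : Euc (n + 1)} (hν : ‖ν‖ = 1) (hAν : ∀ v, ⟪A v, ν⟫ = 0) {z : Euc (n + 1)}
    (hz : ⟪z, ν⟫ = 0) : ∃ v, A v = z := by
  have hle : A.toLinearMap.range ≤ (ℝ ∙ ν)ᗮ := by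
    rintro _ ⟨v, rfl⟩
    exact Submodule.mem_orthogonal_singleton_iff_inner_left.2 (hAν v)
  have : Fact (Module.finrank ℝ (Euc (n + 1)) = n + 1) := ⟨by simp⟩
  have hfr : Module.finrank ℝ A.toLinearMap.range = Module.finrank ℝ (ℝ ∙ ν)ᗮ := by
    rw [Submodule.finrank_orthogonal_span_singleton (n := n) (norm_ne_zero_iff.1 (by simp [hν])),
      LinearMap.finrank_range_of_inj hA]
    simp
  have heq := Submodule.eq_of_le_of_finrank_eq hle hfr
  have hzm : z ∈ A.toLinearMap.range := by
    rw [heq]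
    exact Submodule.mem_orthogonal_singleton_iff_inner_left.2 hz
  exact hzm

namespace HypDisk

variable (S : HypDisk n)

/-- The coordinate tangent vector `∂_i X`. -/
def frame (i : Fin n) (x : Euc n) : Euc (n + 1) :=
  fderivWithin ℝ S.X (Disk n) x (EuclideanSpace.single i 1)

theorem gmet_apply (x : Euc n) (i j : Fin n) : gmet S x i j = ⟪S.frame i x, S.frame j x⟫ := rfl

theorem gmet_eq_gram (x : Euc n) : gmet S x = Matrix.gram ℝ fun i => S.frame i x := rfl

theorem fderivWithin_eq_sum_frame (x v : Euc n) :
    fderivWithin ℝ S.X (Disk n) x v = ∑ i, v i • S.frame i x := by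
  conv_lhs => rw [← euc_sum_smul_single v]
  simp [frame]

theorem linearIndependent_frame {x : Euc n} (hx : x ∈ Disk n) :
    LinearIndependent ℝ fun i => S.frame i x := by
  have h := (EuclideanSpace.basisFun (Fin n) ℝ).toBasis.linearIndependent.map'
    (fderivWithin ℝ S.X (Disk n) x).toLinearMap (LinearMap.ker_eq_bot.2 (S.immersion x hx))
  have he : (fun i => S.frame i x) = (fderivWithin ℝ S.X (Disk n) x).toLinearMap ∘
      (EuclideanSpace.basisFun (Fin n) ℝ).toBasis := by
    ext1 i
    simp [frame]
  rw [he]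
  exact h

theorem posDef_gmet {x : Euc n} (hx : x ∈ Disk n) : (gmet S x).PosDef := by
  rw [gmet_eq_gram]
  exact Matrix.posDef_gram_of_linearIndependent (S.linearIndependent_frame hx)

theorem det_gmet_pos {x : Euc n} (hx : x ∈ Disk n) : 0 < (gmet S x).det :=
  (S.posDef_gmet hx).det_pos

theorem sqrt_det_gmet (x : Euc n) :
    √(gmet S x).det = (fderivWithin ℝ S.X (Disk n) x).toLinearMap.normDet := by
  have h := LinearMap.normDet_sq_eq_det_gram (fderivWithin ℝ S.X (Disk n) x).toLinearMap
    (EuclideanSpace.basisFun (Fin n) ℝ)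
  have h2 : (gmet S x).det = (fderivWithin ℝ S.X (Disk n) x).toLinearMap.normDet ^ 2 := by
    simpa [gmet_eq_gram, frame] using h.symm
  rw [h2, Real.sqrt_sq (LinearMap.normDet_nonneg _)]

theorem contDiffOn_fderivWithin :
    ContDiffOn ℝ (⊤ : ℕ∞) (fderivWithin ℝ S.X (Disk n)) (Disk n) :=
  S.smoothX.fderivWithin uniqueDiffOn_disk (by simp)

theorem contDiffOn_frame (i : Fin n) : ContDiffOn ℝ (⊤ : ℕ∞) (S.frame i) (Disk n) :=
  S.contDiffOn_fderivWithin.clm_apply contDiffOn_const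

theorem contDiffOn_gmet (i j : Fin n) :
    ContDiffOn ℝ (⊤ : ℕ∞) (fun x => gmet S x i j) (Disk n) :=
  (S.contDiffOn_frame i).inner ℝ (S.contDiffOn_frame j)

theorem contDiffOn_sqrt_det_gmet :
    ContDiffOn ℝ (⊤ : ℕ∞) (fun x => √(gmet S x).det) (Disk n) :=
  (ContDiffOn.matrix_det S.contDiffOn_gmet).sqrt fun _ hx => (S.det_gmet_pos hx).ne'

theorem continuousOn_meanCurv : ContinuousOn (meanCurv S) (Disk n) := by
  have h : ∀ i j, ContinuousOn (fun x => sff S x i j) (Disk n) := fun i j => by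
    refine ContinuousOn.neg (ContinuousOn.inner ?_ S.smoothN.continuousOn)
    exact (((S.contDiffOn_frame i).continuousOn_fderivWithin uniqueDiffOn_disk
      (by simp)).clm_apply continuousOn_const)
  unfold meanCurv
  simp only [Matrix.trace, Matrix.diag, Matrix.mul_apply]
  exact continuousOn_finsetSum _ fun i _ => continuousOn_finsetSum _ fun j _ =>
    (ContDiffOn.matrix_inv S.contDiffOn_gmet (fun _ hy => (S.det_gmet_pos hy).ne')
      i j).continuousOn.mul (h j i)

/-- The coefficients of the tangential part of `e₀` in the coordinate frame. -/
def tangentialCoeff (e₀ : Euc (n + 1)) (x : Euc n) (i : Fin n) : ℝ :=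
  ∑ j, (gmet S x)⁻¹ i j * ⟪S.frame j x, e₀⟫

theorem contDiffOn_tangentialCoeff (e₀ : Euc (n + 1)) (i : Fin n) :
    ContDiffOn ℝ (⊤ : ℕ∞) (fun x => S.tangentialCoeff e₀ x i) (Disk n) :=
  ContDiffOn.sum fun j _ => (ContDiffOn.matrix_inv S.contDiffOn_gmet
    (fun _ hy => (S.det_gmet_pos hy).ne') i j).mul
      ((S.contDiffOn_frame j).inner ℝ contDiffOn_const)

theorem sum_gmet_mul_tangentialCoeff (e₀ : Euc (n + 1)) {x : Euc n} (hx : x ∈ Disk n)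
    (a : Fin n) : ∑ b, gmet S x a b * S.tangentialCoeff e₀ x b = ⟪S.frame a x, e₀⟫ := by
  have h : (gmet S x).mulVec ((gmet S x)⁻¹.mulVec fun j => ⟪S.frame j x, e₀⟫) =
      fun j => ⟪S.frame j x, e₀⟫ := by
    rw [Matrix.mulVec_mulVec,
      Matrix.mul_nonsing_inv _ (isUnit_iff_ne_zero.2 (S.det_gmet_pos hx).ne'),
      Matrix.one_mulVec]
  exact congrFun h a

theorem tangentialCoeff_eq (e₀ : Euc (n + 1)) {x : Euc n} (hx : x ∈ Disk n) {v : Fin n → ℝ}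
    (hv : ∀ a, ∑ b, gmet S x a b * v b = ⟪S.frame a x, e₀⟫) : S.tangentialCoeff e₀ x = v := by
  have h : (gmet S x).mulVec v = fun j => ⟪S.frame j x, e₀⟫ := funext hv
  have h2 : S.tangentialCoeff e₀ x = (gmet S x)⁻¹.mulVec ((gmet S x).mulVec v) := by
    rw [h]; rfl
  rw [h2, Matrix.mulVec_mulVec,
    Matrix.nonsing_inv_mul _ (isUnit_iff_ne_zero.2 (S.det_gmet_pos hx).ne'), Matrix.one_mulVec]

theorem exists_fderivWithin_eq {x : Euc n} (hx : x ∈ Disk n) {z : Euc (n + 1)}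
    (hz : ⟪z, S.N x⟫ = 0) : ∃ v, fderivWithin ℝ S.X (Disk n) x v = z :=
  exists_eq_of_inner_eq_zero (S.immersion x hx) (S.unitN x hx) (S.perpN x hx) hz

theorem eq_sum_tangentialCoeff_add (e₀ : Euc (n + 1)) {x : Euc n} (hx : x ∈ Disk n) :
    e₀ = ∑ b, S.tangentialCoeff e₀ x b • S.frame b x + ⟪S.N x, e₀⟫ • S.N x := by
  obtain ⟨v, hv⟩ := S.exists_fderivWithin_eq hx (z := e₀ - ⟪S.N x, e₀⟫ • S.N x) (by
    rw [inner_sub_left, inner_smul_left, real_inner_self_eq_norm_sq, S.unitN x hx,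
      real_inner_comm]
    simp)
  have hc : S.tangentialCoeff e₀ x = v := by
    refine S.tangentialCoeff_eq e₀ hx fun a => ?_
    have h1 : ⟪S.frame a x, fderivWithin ℝ S.X (Disk n) x v⟫ = ⟪S.frame a x, e₀⟫ := by
      rw [hv, inner_sub_right, inner_smul_right, frame, S.perpN x hx]
      simp
    rw [← h1, fderivWithin_eq_sum_frame, inner_sum]
    exact Finset.sum_congr rfl fun b _ => by rw [inner_smul_right, gmet_apply, mul_comm]
  rw [hc, ← fderivWithin_eq_sum_frame, hv]
  abel

/-- The vector field `√det g · g⁻¹ ⟪∂X, e₀⟫` representing the gradient of the height function. -/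
def heightField (e₀ : Euc (n + 1)) (x : Euc n) : Euc n :=
  WithLp.toLp 2 fun i => √(gmet S x).det * S.tangentialCoeff e₀ x i

theorem contDiffOn_heightField (e₀ : Euc (n + 1)) :
    ContDiffOn ℝ 1 (S.heightField e₀) (Disk n) := by
  refine (contDiffOn_euclidean.2 fun i => ?_ :
    ContDiffOn ℝ (⊤ : ℕ∞) (S.heightField e₀) (Disk n)).of_le (by simp)
  exact S.contDiffOn_sqrt_det_gmet.mul (S.contDiffOn_tangentialCoeff e₀ i)

/-- The height function satisfies `Δ⟪X, e₀⟫ = -H ⟪N, e₀⟫`. -/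
theorem divergence_heightField (e₀ : Euc (n + 1)) {x : Euc n} (hx : x ∈ ball (0 : Euc n) 1) :
    ∑ i, fderiv ℝ (fun y => S.heightField e₀ y i) x (EuclideanSpace.single i 1) =
      -(meanCurv S x * ⟪S.N x, e₀⟫ * √(gmet S x).det) := by
  have hmem := disk_mem_nhds hx
  have hxD := ball_subset_disk hx
  have hX2 : ContDiffAt ℝ 2 S.X x := (contDiffOn_infty.1 S.smoothX 2).contDiffAt hmem
  have hfr : ∀ i, HasFDerivAt (S.frame i) (fderiv ℝ (S.frame i) x) x := fun i =>
    (((S.contDiffOn_frame i).contDiffAt hmem).differentiableAt (by simp)).hasFDerivAt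
  have hD : fderivWithin ℝ S.X (Disk n) =ᶠ[nhds x] fderiv ℝ S.X := by
    filter_upwards [isOpen_ball.mem_nhds hx] with y hy
    exact fderivWithin_of_mem_nhds (disk_mem_nhds hy)
  have hval : ∀ i v, fderiv ℝ (S.frame i) x v =
      fderiv ℝ (fderiv ℝ S.X) x v (EuclideanSpace.single i 1) := fun i v => by
    have h1 : S.frame i =ᶠ[nhds x] fun y => fderiv ℝ S.X y (EuclideanSpace.single i 1) := by
      filter_upwards [hD] with y hy
      rw [frame, hy]
    have h2 : DifferentiableAt ℝ (fderiv ℝ S.X) x :=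
      (hX2.fderiv_right (m := 1) (by norm_num)).differentiableAt (by simp)
    rw [h1.fderiv_eq, fderiv_clm_apply h2 (differentiableAt_const _)]
    simp
  have hsymm : ∀ i j, fderiv ℝ (S.frame i) x (EuclideanSpace.single j 1) =
      fderiv ℝ (S.frame j) x (EuclideanSpace.single i 1) := fun i j => by
    rw [hval, hval]
    exact hX2.isSymmSndFDerivAt (by simp) _ _
  have key := sum_fderiv_sqrt_det_mul (B := S.frame) hfr hsymm (g := gmet S)
    (fun _ _ _ => rfl) (S.det_gmet_pos hxD) (W := S.tangentialCoeff e₀)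
    (fun i => (((S.contDiffOn_tangentialCoeff e₀ i).contDiffAt hmem).differentiableAt
      (by simp)).hasFDerivAt)
    (by filter_upwards [hmem] with y hy a using S.sum_gmet_mul_tangentialCoeff e₀ hy a)
    (S.eq_sum_tangentialCoeff_add e₀ hxD)
  refine key.trans ?_
  have hH : meanCurv S x = -∑ i, ∑ a, (gmet S x)⁻¹ i a *
      ⟪fderiv ℝ (S.frame a) x (EuclideanSpace.single i 1), S.N x⟫ := by
    simp only [meanCurv, Matrix.trace, Matrix.diag, Matrix.mul_apply, ← Finset.sum_neg_distrib]
    refine Finset.sum_congr rfl fun i _ => Finset.sum_congr rfl fun a _ => ?_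
    rw [← mul_neg]
    congr 2
    rw [← fderivWithin_of_mem_nhds hmem]
    rfl
  rw [hH]
  ring

theorem meanCurv_nonneg (h : StrictlyConvex S) {x : Euc n} (hx : x ∈ Disk n) :
    0 ≤ meanCurv S x := by
  have h0 := (isUnit_iff_ne_zero.2 (S.det_gmet_pos hx).ne')
  obtain ⟨C, hC⟩ : ∃ C : Matrix (Fin (n + 1)) (Fin n) ℝ, (gmet S x)⁻¹ = C.conjTranspose * C := by
    obtain ⟨B, hB⟩ : ∃ B : Matrix (Fin (n + 1)) (Fin n) ℝ, gmet S x = B.conjTranspose * B :=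
      ⟨_, Matrix.gram_eq_conjTranspose_mul (EuclideanSpace.basisFun (Fin (n + 1)) ℝ) _⟩
    refine ⟨B * (gmet S x)⁻¹, ?_⟩
    rw [Matrix.conjTranspose_mul, (S.posDef_gmet hx).inv.isHermitian.eq, Matrix.mul_assoc,
      ← Matrix.mul_assoc _ B, ← hB, Matrix.mul_nonsing_inv _ h0, Matrix.mul_one]
  rw [meanCurv, hC, Matrix.mul_assoc, Matrix.trace_mul_comm]
  exact ((h x hx).posSemidef.mul_mul_conjTranspose_same C).trace_nonneg

end HypDisk

end Geometry

section NormDetHyperplane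

variable {E F : Type*} [NormedAddCommGroup E] [InnerProductSpace ℝ E] [FiniteDimensional ℝ E]
  [NormedAddCommGroup F] [InnerProductSpace ℝ F]

/-- If `A a` is a unit vector orthogonal to the image of `θᗮ`, the volume factor of `A` on `θᗮ`
is the one of `A` times `|⟪θ, a⟫|`. -/
theorem normDet_comp_subtype_orthogonal {A : E →ₗ[ℝ] F} {θ a : E} (hθ : ‖θ‖ = 1)
    (ha : ‖A a‖ = 1) (hperp : ∀ τ, ⟪θ, τ⟫ = 0 → ⟪A τ, A a⟫ = 0) :
    (A ∘ₗ (ℝ ∙ θ)ᗮ.subtype).normDet = A.normDet * |⟪θ, a⟫| := by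
  let K : E →ₗ[ℝ] E := LinearMap.transvection (innerₛₗ ℝ θ) (a - θ)
  have hK : ∀ v, K v = v + ⟪θ, v⟫ • (a - θ) := fun v => rfl
  have hdetK : K.normDet = |⟪θ, a⟫| := by
    rw [LinearMap.normDet_eq_abs_det, LinearMap.transvection.det]
    simp [inner_sub_right, hθ]
  let U := (unitFrame θ hθ).toLinearMap
  have hθ0 : θ ≠ 0 := norm_ne_zero_iff.1 (by simp [hθ])
  have hfr : Module.finrank ℝ (WithLp 2 ((ℝ ∙ θ)ᗮ × ℝ)) = Module.finrank ℝ E := by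
    have h1 : Module.finrank ℝ (WithLp 2 ((ℝ ∙ θ)ᗮ × ℝ)) = Module.finrank ℝ ((ℝ ∙ θ)ᗮ × ℝ) :=
      (WithLp.linearEquiv 2 ℝ ((ℝ ∙ θ)ᗮ × ℝ)).finrank_eq
    have h2 := Submodule.finrank_add_finrank_orthogonal (ℝ ∙ θ)
    rw [finrank_span_singleton hθ0] at h2
    rw [h1, Module.finrank_prod, Module.finrank_self]
    omega
  have hR : (A ∘ₗ K ∘ₗ U).normDet = A.normDet * |⟪θ, a⟫| := by
    rw [← LinearMap.comp_assoc, LinearMap.normDet_comp_of_finrank_eq _ _ hfr,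
      LinearMap.normDet_comp_of_finrank_eq _ _ rfl, hdetK,
      LinearIsometry.normDet_eq_one, mul_one]
  rw [← hR, ← sq_eq_sq₀ (LinearMap.normDet_nonneg _) (LinearMap.normDet_nonneg _)]
  let b := stdOrthonormalBasis ℝ (ℝ ∙ θ)ᗮ
  have h1 := LinearMap.normDet_sq_eq_det_gram (A ∘ₗ (ℝ ∙ θ)ᗮ.subtype) b
  have h2 := LinearMap.normDet_sq_eq_det_gram (A ∘ₗ K ∘ₗ U)
    (b.prod (OrthonormalBasis.singleton (Fin 1) ℝ))
  simp only [RCLike.ofReal_real_eq_id, id] at h1 h2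
  rw [h1, h2]
  have hτ : ∀ i, ⟪θ, (b i : E)⟫ = 0 := fun i =>
    Submodule.mem_orthogonal_singleton_iff_inner_right.1 (b i).2
  have hl : ∀ i, (A ∘ₗ K ∘ₗ U) (b.prod (OrthonormalBasis.singleton (Fin 1) ℝ) (Sum.inl i)) =
      A (b i) := fun i => by
    have : U (b.prod (OrthonormalBasis.singleton (Fin 1) ℝ) (Sum.inl i)) = b i := by
      simp [U, unitFrame_apply]
    rw [LinearMap.comp_apply, LinearMap.comp_apply, this, hK, hτ]
    simp
  have hr : ∀ i, (A ∘ₗ K ∘ₗ U) (b.prod (OrthonormalBasis.singleton (Fin 1) ℝ) (Sum.inr i)) =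
      A a := fun i => by
    have : U (b.prod (OrthonormalBasis.singleton (Fin 1) ℝ) (Sum.inr i)) = θ := by
      simp [U, unitFrame_apply]
    rw [LinearMap.comp_apply, LinearMap.comp_apply, this, hK, real_inner_self_eq_norm_sq, hθ]
    simp
  have hblock : Matrix.gram ℝ
      (fun i => (A ∘ₗ K ∘ₗ U) (b.prod (OrthonormalBasis.singleton (Fin 1) ℝ) i)) =
      Matrix.fromBlocks (Matrix.gram ℝ fun i => (A ∘ₗ (ℝ ∙ θ)ᗮ.subtype) (b i)) 0 0 1 := by
    ext i j
    rcases i with i | i <;> rcases j with j | j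
    · simp only [Matrix.gram_apply, hl, Matrix.fromBlocks_apply₁₁]; rfl
    · simp only [Matrix.gram_apply, hl, hr, Matrix.fromBlocks_apply₁₂]
      exact hperp _ (hτ i)
    · simp only [Matrix.gram_apply, hl, hr, Matrix.fromBlocks_apply₂₁]
      rw [real_inner_comm]
      exact hperp _ (hτ j)
    · simp only [Matrix.gram_apply, hr, Matrix.fromBlocks_apply₂₂, real_inner_self_eq_norm_sq, ha,
        Subsingleton.elim i j]
      simp
  rw [hblock, Matrix.det_fromBlocks_zero₂₁, Matrix.det_one, mul_one]

end NormDetHyperplane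

section Boundary

namespace HypDisk

variable {n : ℕ} (S : HypDisk n)

theorem hasFDerivWithinAt {x : Euc n} (hx : x ∈ Disk n) :
    HasFDerivWithinAt S.X (fderivWithin ℝ S.X (Disk n) x) (Disk n) x :=
  ((S.smoothX x hx).differentiableWithinAt (by simp)).hasFDerivWithinAt

variable {S}

theorem inner_fderivWithin_tangent (h : PerpFromInside S) {x τ : Euc n} (hx : x ∈ DiskBdry n)
    (hτ : ⟪x, τ⟫ = 0) : ⟪fderivWithin ℝ S.X (Disk n) x τ, S.X x⟫ = 0 := by
  have hxn : ‖x‖ = 1 := by simpa [DiskBdry] using hx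
  have hxD : x ∈ Disk n := sphere_subset_closedBall hx
  suffices hu : ∀ u : Euc n, ‖u‖ = 1 → ⟪x, u⟫ = 0 →
      ⟪fderivWithin ℝ S.X (Disk n) x u, S.X x⟫ = 0 by
    rcases eq_or_ne τ 0 with rfl | h0
    · simp
    · have h0' : ‖τ‖ ≠ 0 := norm_ne_zero_iff.2 h0
      have h1 := hu (‖τ‖⁻¹ • τ) (by rw [norm_smul, norm_inv, norm_norm, inv_mul_cancel₀ h0'])
        (by rw [inner_smul_right, hτ, mul_zero])
      rw [map_smul, inner_smul_left] at h1
      simpa [h0'] using h1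
  intro u hun hxu
  let c : ℝ → Euc n := fun t => Real.cos t • x + Real.sin t • u
  have hc0 : c 0 = x := by simp [c]
  have hcs : ∀ t, c t ∈ DiskBdry n := fun t => by
    have h2 : ‖c t‖ ^ 2 = 1 := by
      rw [norm_add_sq_real, inner_smul_left, inner_smul_right, hxu, norm_smul, norm_smul, hxn, hun]
      simp [Real.cos_sq_add_sin_sq]
    have h3 : ‖c t‖ = 1 := by
      rw [← sq_eq_sq₀ (norm_nonneg _) zero_le_one, h2, one_pow]
    simpa [DiskBdry] using h3
  have hcd : HasDerivAt c u 0 := by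
    exact (((Real.hasDerivAt_cos 0).smul_const x).fun_add
      ((Real.hasDerivAt_sin 0).smul_const u)).congr_deriv (by simp)
  have hX : HasFDerivWithinAt S.X (fderivWithin ℝ S.X (Disk n) x) (Disk n) (c 0) := by
    rw [hc0]; exact S.hasFDerivWithinAt hxD
  have hcomp : HasDerivAt (S.X ∘ c) (fderivWithin ℝ S.X (Disk n) x u) 0 :=
    hX.comp_hasDerivAt 0 hcd (Eventually.of_forall fun t => sphere_subset_closedBall (hcs t))
  have hsq := hcomp.inner ℝ hcomp
  have hone : (fun t => ⟪(S.X ∘ c) t, (S.X ∘ c) t⟫) = fun _ => (1 : ℝ) := by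
    ext t
    have := h.1 (c t) (hcs t)
    rw [real_inner_self_eq_norm_sq, Function.comp_apply, mem_sphere_zero_iff_norm.1 this, one_pow]
  rw [hone] at hsq
  have h4 := hsq.unique (hasDerivAt_const 0 1)
  rw [Function.comp_apply, hc0, real_inner_comm] at h4
  linarith

theorem inner_fderivWithin_self_nonneg (h : PerpFromInside S) {x : Euc n} (hx : x ∈ DiskBdry n) :
    0 ≤ ⟪fderivWithin ℝ S.X (Disk n) x x, S.X x⟫ := by
  have hxn : ‖x‖ = 1 := by simpa [DiskBdry] using hx
  have hxD : x ∈ Disk n := sphere_subset_closedBall hx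
  have hm : ∀ t ∈ Icc (-1 : ℝ) 0, (1 + t) • x ∈ Disk n := fun t ht => by
    have : ‖(1 + t) • x‖ ≤ 1 := by
      rw [norm_smul, hxn, mul_one, Real.norm_of_nonneg (by linarith [ht.1])]
      linarith [ht.2]
    simpa [Disk] using this
  have hl : HasDerivWithinAt (fun t : ℝ => (1 + t) • x) x (Icc (-1) 0) 0 := by
    simpa using (((hasDerivAt_id (0 : ℝ)).const_add 1).smul_const x).hasDerivWithinAt
  have hX : HasFDerivWithinAt S.X (fderivWithin ℝ S.X (Disk n) x) (Disk n)
      ((1 + (0 : ℝ)) • x) := by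
    simpa using S.hasFDerivWithinAt hxD
  have h3 := h.2.2 (fun t => S.X ((1 + t) • x)) 1 one_pos
    ((S.smoothX.of_le (by simp)).comp (by fun_prop) hm)
    (fun t ht => ⟨_, hm t ht, rfl⟩) ⟨x, hx, by simp⟩ _
    (hX.comp_hasDerivWithinAt (t := Disk n) 0 hl hm)
  simpa using h3

theorem exists_preimage_position (h : PerpFromInside S) {x : Euc n} (hx : x ∈ DiskBdry n) :
    ∃ a, fderivWithin ℝ S.X (Disk n) x a = S.X x ∧
      ⟪x, a⟫ * ⟪fderivWithin ℝ S.X (Disk n) x x, S.X x⟫ = 1 := by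
  have hxn : ‖x‖ = 1 := by simpa [DiskBdry] using hx
  have hxD : x ∈ Disk n := sphere_subset_closedBall hx
  obtain ⟨a, ha⟩ := S.exists_fderivWithin_eq hxD (z := S.X x)
    (by rw [real_inner_comm]; exact h.2.1 x hx)
  refine ⟨a, ha, ?_⟩
  have h1 : ⟪fderivWithin ℝ S.X (Disk n) x (a - ⟪x, a⟫ • x), S.X x⟫ = 0 :=
    inner_fderivWithin_tangent h hx (by
      rw [inner_sub_right, inner_smul_right, real_inner_self_eq_norm_sq, hxn]; ring)
  rw [map_sub, map_smul, inner_sub_left, inner_smul_left, ha, real_inner_self_eq_norm_sq,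
    mem_sphere_zero_iff_norm.1 (h.1 x hx)] at h1
  simp at h1
  linarith

theorem inner_fderivWithin_self_pos (h : PerpFromInside S) {x : Euc n} (hx : x ∈ DiskBdry n) :
    0 < ⟪fderivWithin ℝ S.X (Disk n) x x, S.X x⟫ := by
  obtain ⟨a, -, ha⟩ := exists_preimage_position h hx
  refine (inner_fderivWithin_self_nonneg h hx).lt_of_ne fun h0 => ?_
  rw [← h0, mul_zero] at ha
  exact zero_ne_one ha

variable (S) in
/-- The density of the boundary measure of `∂M` with respect to the one of `∂𝔻`. -/
def bdryDensity (x : Euc n) : ℝ :=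
  √(gmet S x).det / ⟪fderivWithin ℝ S.X (Disk n) x x, S.X x⟫

theorem bdryDensity_pos (h : PerpFromInside S) {x : Euc n} (hx : x ∈ DiskBdry n) :
    0 < S.bdryDensity x :=
  div_pos (Real.sqrt_pos.2 (S.det_gmet_pos (sphere_subset_closedBall hx)))
    (inner_fderivWithin_self_pos h hx)

theorem continuousOn_bdryDensity (h : PerpFromInside S) :
    ContinuousOn S.bdryDensity (DiskBdry n) := by
  have hsub : DiskBdry n ⊆ Disk n := sphere_subset_closedBall
  refine (S.contDiffOn_sqrt_det_gmet.continuousOn.mono hsub).div ?_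
    fun x hx => (inner_fderivWithin_self_pos h hx).ne'
  exact ((S.contDiffOn_fderivWithin.continuousOn.clm_apply continuousOn_id).inner
    S.smoothX.continuousOn).mono hsub

theorem normDet_fderivWithin_tangent (h : PerpFromInside S) {x : Euc n} (hx : x ∈ DiskBdry n) :
    ((fderivWithin ℝ S.X (Disk n) x).toLinearMap ∘ₗ (ℝ ∙ x)ᗮ.subtype).normDet =
      S.bdryDensity x := by
  have hxn : ‖x‖ = 1 := by simpa [DiskBdry] using hx
  obtain ⟨a, ha, hα⟩ := exists_preimage_position h hx
  have hpos := inner_fderivWithin_self_pos h hx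
  have h1 := normDet_comp_subtype_orthogonal (A := (fderivWithin ℝ S.X (Disk n) x).toLinearMap)
    (a := a) hxn
    (by rw [ContinuousLinearMap.coe_coe, ha]; exact mem_sphere_zero_iff_norm.1 (h.1 x hx))
    (fun τ hτ => by
      simp only [ContinuousLinearMap.coe_coe, ha]
      exact inner_fderivWithin_tangent h hx hτ)
  have hα' : ⟪x, a⟫ = (⟪fderivWithin ℝ S.X (Disk n) x x, S.X x⟫)⁻¹ :=
    eq_inv_of_mul_eq_one_left hα
  rw [h1, ← sqrt_det_gmet, hα', abs_of_pos (inv_pos.2 hpos), bdryDensity, div_eq_mul_inv]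

/-- The Neumann condition for the height function along the boundary. -/
theorem inner_heightField (h : PerpFromInside S) (e₀ : Euc (n + 1)) {x : Euc n}
    (hx : x ∈ DiskBdry n) : ⟪S.heightField e₀ x, x⟫ = S.bdryDensity x * ⟪S.X x, e₀⟫ := by
  have hxn : ‖x‖ = 1 := by simpa [DiskBdry] using hx
  have hxD : x ∈ Disk n := sphere_subset_closedBall hx
  have hpos := inner_fderivWithin_self_pos h hx
  let W : Euc n := WithLp.toLp 2 (S.tangentialCoeff e₀ x)
  have hV : S.heightField e₀ x = √(gmet S x).det • W := by
    ext i
    simp [heightField, W]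
  have he := S.eq_sum_tangentialCoeff_add e₀ hxD
  have hAW : fderivWithin ℝ S.X (Disk n) x W = ∑ b, S.tangentialCoeff e₀ x b • S.frame b x :=
    S.fderivWithin_eq_sum_frame x W
  rw [← hAW] at he
  have h1 : ⟪fderivWithin ℝ S.X (Disk n) x (W - ⟪x, W⟫ • x), S.X x⟫ = 0 :=
    inner_fderivWithin_tangent h hx (by
      rw [inner_sub_right, inner_smul_right, real_inner_self_eq_norm_sq, hxn]; ring)
  rw [map_sub, map_smul, inner_sub_left, inner_smul_left, sub_eq_zero] at h1
  have h2 : ⟪S.X x, e₀⟫ = ⟪x, W⟫ * ⟪fderivWithin ℝ S.X (Disk n) x x, S.X x⟫ := by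
    conv_lhs => rw [he]
    rw [inner_add_right, inner_smul_right, real_inner_comm (S.N x) (S.X x), h.2.1 x hx,
      mul_zero, add_zero, real_inner_comm, h1]
    simp
  rw [hV, inner_smul_left, h2, bdryDensity, real_inner_comm]
  simp only [conj_trivial]
  field_simp

variable (S) in
theorem exists_norm_sub_fderivWithin_le {x₀ : Euc n} (hx₀ : x₀ ∈ Disk n) {η : ℝ} (hη : 0 < η) :
    ∃ ρ > 0, ∀ x ∈ Disk n, ∀ y ∈ Disk n, ‖x - x₀‖ < ρ → ‖y - x₀‖ < ρ →
      ‖S.X x - S.X y - fderivWithin ℝ S.X (Disk n) x₀ (x - y)‖ ≤ η * ‖x - y‖ := by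
  obtain ⟨ρ, hρ, hb⟩ := Metric.continuousWithinAt_iff.1
    (S.contDiffOn_fderivWithin.continuousOn x₀ hx₀) η hη
  refine ⟨ρ, hρ, fun x hx y hy hxρ hyρ => ?_⟩
  refine Convex.norm_image_sub_le_of_norm_hasFDerivWithin_le' (s := Disk n ∩ ball x₀ ρ)
    (f' := fderivWithin ℝ S.X (Disk n)) (fun z hz => ?_) (fun z hz => ?_)
    ((convex_closedBall _ _).inter (convex_ball _ _)) ⟨hy, by rwa [mem_ball, dist_eq_norm]⟩
    ⟨hx, by rwa [mem_ball, dist_eq_norm]⟩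
  · exact (S.hasFDerivWithinAt hz.1).mono inter_subset_left
  · rw [← dist_eq_norm]
    exact (hb hz.1 hz.2).le

end HypDisk

end Boundary

section Boundary

theorem addHaarScalarFactor_volume_hausdorffMeasure_le_one (d : ℕ) :
    Measure.addHaarScalarFactor (volume : Measure (EuclideanSpace ℝ (Fin d))) μH[d] ≤ 1 := by
  set c := Measure.addHaarScalarFactor (volume : Measure (EuclideanSpace ℝ (Fin d))) μH[d] with hc
  let Q : Set (EuclideanSpace ℝ (Fin d)) := WithLp.ofLp ⁻¹' Icc (0 : Fin d → ℝ) 1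
  have hvol : volume (Icc (0 : Fin d → ℝ) 1) = 1 := by simp [Real.volume_Icc_pi]
  have hQ : volume Q = 1 := by
    rw [(PiLp.volume_preserving_ofLp (Fin d)).measure_preimage
      measurableSet_Icc.nullMeasurableSet, hvol]
  have hcQ : (c : ℝ≥0∞) * μH[d] Q = 1 := by
    rw [← hQ, ← EuclideanSpace.euclideanHausdorffMeasure_eq_volume,
      Measure.euclideanHausdorffMeasure_def]
    rfl
  have hle : 1 ≤ μH[d] Q := by
    have h1 := (PiLp.lipschitzWith_ofLp 2 fun _ : Fin d => ℝ).hausdorffMeasure_image_le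
      (Nat.cast_nonneg d) Q
    have h2 : (μH[d] : Measure (Fin d → ℝ)) = volume := by
      simpa using hausdorffMeasure_pi_real (ι := Fin d)
    have h3 : WithLp.ofLp '' Q = Icc (0 : Fin d → ℝ) 1 :=
      image_preimage_eq _ (WithLp.ofLp_surjective 2)
    rw [h3, h2, hvol] at h1
    simpa using h1
  have : (c : ℝ≥0∞) ≤ 1 := by
    calc (c : ℝ≥0∞) = c * 1 := (mul_one _).symm
      _ ≤ c * μH[d] Q := by gcongr
      _ = 1 := hcQ
  exact_mod_cast this

theorem integral_euclideanHausdorffMeasure_le {X : Type*} [EMetricSpace X] [MeasurableSpace X]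
    [BorelSpace X] {d : ℕ} {s : Set X} {f : X → ℝ} (h : 0 ≤ ∫ x in s, f x ∂(μHE[d])) :
    ∫ x in s, f x ∂(μHE[d]) ≤ ∫ x in s, f x ∂(μH[d]) := by
  rw [Measure.euclideanHausdorffMeasure_def, Measure.restrict_smul, integral_smul_nnreal_measure,
    NNReal.smul_def, smul_eq_mul] at h ⊢
  have h0 := Measure.addHaarScalarFactor_volume_hausdorffMeasure_ne_zero d
  have h1 := addHaarScalarFactor_volume_hausdorffMeasure_le_one d
  refine mul_le_of_le_one_left (nonneg_of_mul_nonneg_right h ?_) (by exact_mod_cast h1)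
  exact_mod_cast pos_iff_ne_zero.2 h0

namespace HypDisk

theorem integral_bdryDensity {d : ℕ} {S : HypDisk (d + 1)} (h : PerpFromInside S)
    (φ : Euc (d + 1 + 1) → ℝ) :
    ∫ θ : sphere (0 : Euc (d + 1)) 1, S.bdryDensity θ * φ (S.X θ)
        ∂(volume : Measure (Euc (d + 1))).toSphere =
      ∫ y in S.X '' DiskBdry (d + 1), φ y ∂(μHE[d]) := by
  have hsub : DiskBdry (d + 1) ⊆ Disk (d + 1) := sphere_subset_closedBall
  have hmem (θ : sphere (0 : Euc (d + 1)) 1) : (θ : Euc (d + 1)) ∈ Disk (d + 1) := hsub θ.2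
  have hcont : Continuous fun θ : sphere (0 : Euc (d + 1)) 1 => S.X θ :=
    (S.smoothX.continuousOn.mono hsub).domRestrict
  have hinj : Function.Injective fun θ : sphere (0 : Euc (d + 1)) 1 => S.X θ :=
    fun a b hab => Subtype.ext (S.injX (hmem a) (hmem b) hab)
  have hemb : MeasurableEmbedding fun θ : sphere (0 : Euc (d + 1)) 1 => S.X θ :=
    (hcont.isClosedEmbedding hinj).measurableEmbedding
  have hjc : Continuous fun θ : sphere (0 : Euc (d + 1)) 1 => S.bdryDensity θ :=
    (continuousOn_bdryDensity h).domRestrict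
  have hcomap := comap_euclideanHausdorffMeasure_sphere (d := d) (by simp)
    (f' := fderivWithin ℝ S.X (Disk (d + 1))) hemb
    (fun θ => S.immersion θ (hmem θ))
    (fun θ η hη => by
      obtain ⟨ρ, hρ, hb⟩ := S.exists_norm_sub_fderivWithin_le (hmem θ) hη
      exact ⟨ρ, hρ, fun x y hx hy => hb x (hsub (by simpa [DiskBdry] using hx)) y
        (hsub (by simpa [DiskBdry] using hy))⟩)
    hjc (fun θ => bdryDensity_pos h θ.2) (fun θ => normDet_fderivWithin_tangent h θ.2)
  have hrange : range (fun θ : sphere (0 : Euc (d + 1)) 1 => S.X θ) = S.X '' DiskBdry (d + 1) := by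
    rw [image_eq_range]; rfl
  rw [← hrange, ← hemb.map_comap, hemb.integral_map, hcomap,
    integral_withDensity_eq_integral_toReal_smul hjc.measurable.ennreal_ofReal (by simp)]
  refine integral_congr_ae (Eventually.of_forall fun θ => ?_)
  simp [ENNReal.toReal_ofReal (bdryDensity_pos h θ.2).le]

variable {n : ℕ} (S : HypDisk n)

theorem surfIntegral_meanCurv_mul_inner {d : ℕ} {S : HypDisk (d + 1)} (h : PerpFromInside S)
    (e₀ : Euc (d + 1 + 1)) :
    surfIntegral S (fun x => -(meanCurv S x * ⟪S.N x, e₀⟫)) =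
      ∫ y in S.X '' DiskBdry (d + 1), ⟪y, e₀⟫ ∂(μHE[d]) := by
  have hD : ContinuousOn (fun x => -(meanCurv S x * ⟪S.N x, e₀⟫ * √(gmet S x).det))
      (Disk (d + 1)) :=
    ((S.continuousOn_meanCurv.mul (S.smoothN.continuousOn.inner continuousOn_const)).mul
      S.contDiffOn_sqrt_det_gmet.continuousOn).neg
  rw [← integral_bdryDensity h fun y => ⟪y, e₀⟫]
  simp only [surfIntegral, neg_mul]
  rw [show Disk (d + 1) = closedBall 0 1 from rfl,
    integral_divergence_ball d.succ_pos (S.contDiffOn_heightField e₀) hD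
      fun x hx => (S.divergence_heightField e₀ hx).symm]
  exact integral_congr_ae (Eventually.of_forall fun θ => inner_heightField h e₀ θ.2)

variable {S}

theorem surfIntegral_meanCurv_nonneg (hc : StrictlyConvex S) :
    0 ≤ surfIntegral S (meanCurv S) :=
  setIntegral_nonneg isClosed_closedBall.measurableSet fun _ hx =>
    mul_nonneg (S.meanCurv_nonneg hc hx) (Real.sqrt_nonneg _)

theorem mul_surfIntegral_meanCurv_le (hc : StrictlyConvex S) {e₀ : Euc (n + 1)} {c₀ : ℝ}
    (hN : ∀ x ∈ Disk n, ⟪S.N x, e₀⟫ ≤ c₀) :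
    -c₀ * surfIntegral S (meanCurv S) ≤
      surfIntegral S (fun x => -(meanCurv S x * ⟪S.N x, e₀⟫)) := by
  have hK : IsCompact (Disk n) := isCompact_closedBall 0 1
  have hg : ContinuousOn (fun x => √(gmet S x).det) (Disk n) :=
    S.contDiffOn_sqrt_det_gmet.continuousOn
  have hH := S.continuousOn_meanCurv
  rw [surfIntegral, surfIntegral, ← integral_const_mul]
  refine setIntegral_mono_on (((hH.mul hg).integrableOn_compact hK).const_mul _)
    (((hH.mul (S.smoothN.continuousOn.inner continuousOn_const)).neg.mul
      hg).integrableOn_compact hK) isClosed_closedBall.measurableSet fun x hx => ?_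
  have h1 : 0 ≤ meanCurv S x * √(gmet S x).det :=
    mul_nonneg (S.meanCurv_nonneg hc hx) (Real.sqrt_nonneg _)
  nlinarith [mul_le_mul_of_nonneg_left (hN x hx) h1]

end HypDisk

end Boundary

/-- If `M` is a strictly convex embedded `n`-disk perpendicular to `S^n` from the
inside and `⟨N, e₀⟩ ≤ c₀ < 0` on `M` for a unit vector `e₀`, then
`∫_M H dμ ≤ -c₀⁻¹ ∫_{∂M} ⟨x, e₀⟩ dσ(x)`. -/
theorem integral_H_bound (n : ℕ) (S : HypDisk n)
    (hconv : StrictlyConvex S) (hperp : PerpFromInside S)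
    (e₀ : Euc (n + 1)) (he₀ : ‖e₀‖ = 1) (c₀ : ℝ) (hc₀ : c₀ < 0)
    (hN : ∀ x ∈ Disk n, ⟪S.N x, e₀⟫ ≤ c₀) :
    surfIntegral S (meanCurv S) ≤
      -c₀⁻¹ * ∫ y in S.X '' DiskBdry n, ⟪y, e₀⟫ ∂(μH[(n : ℝ) - 1]) := by
  rcases n with _ | d
  · have h0 : DiskBdry 0 = ∅ := by
      ext x
      simp [DiskBdry, Subsingleton.elim x 0]
    simp [h0, surfIntegral, meanCurv, Matrix.trace]
  have hle := HypDisk.mul_surfIntegral_meanCurv_le hconv hN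
  have hnonneg := mul_nonneg (neg_nonneg.2 hc₀.le) (HypDisk.surfIntegral_meanCurv_nonneg hconv)
  rw [HypDisk.surfIntegral_meanCurv_mul_inner hperp] at hle
  have hd : ((d + 1 : ℕ) : ℝ) - 1 = d := by push_cast; ring
  have h := hle.trans (integral_euclideanHausdorffMeasure_le (hnonneg.trans hle))
  rw [hd, ← inv_neg, ← div_eq_inv_mul, le_div_iff₀' (neg_pos.2 hc₀)]
  exact h

end
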